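/- Let n ∈ ℕ with n ≥ 1 and let 0 < p < q < ∞. Then for every polynomial f of degree at most n one has ‖f‖_{P_n,q} ≤ ‖f‖_{P_n,p}, with equality if and only if f = 0 or ‖f‖_{P_n,p}⁻¹ f ∈ M₂. (This is Bodmann's conjectured reverse Hölder inequality for polynomials.) -/

import Mathlib

open MeasureTheory

/-- The norm `‖f‖_{P_n,p} = (((pn/2+1)/π) ∫_ℂ |f(z)|^p (1+|z|²)^{−pn/2−2} dA(z))^{1/p}`. -/
noncomputable def polyNorm (n : ℕ) (p : ℝ) (f : Polynomial ℂ) : ℝ :=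
  ((p*(n:ℝ)/2 + 1)/Real.pi *
    ∫ z : ℂ, ‖f.eval z‖ ^ p * (1 + ‖z‖^2) ^ (-(p*(n:ℝ)/2) - 2)) ^ (1/p)

/-- The optimizer set `M₂`: the polynomials whose values are
`e^{iθ} (1 + conj(w) z)^n / (1+|w|²)^{n/2}` or `e^{iθ} z^n`. -/
def polyOpt (n : ℕ) : Set (Polynomial ℂ) :=
  {f | ∃ θ : ℝ,
    (∃ w : ℂ, ∀ z : ℂ, f.eval z =
      Complex.exp (Complex.I * (θ:ℂ)) * (1 + (starRingEnd ℂ) w * z)^n /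
        ((((1 + ‖w‖^2) ^ ((n:ℝ)/2) : ℝ)) : ℂ)) ∨
    (∀ z : ℂ, f.eval z = Complex.exp (Complex.I * (θ:ℂ)) * z^n)}

namespace SphereHolder

open Set Filter Topology ComplexConjugate

/-- The density of the normalized area measure of the sphere in the stereographic coordinate. -/
noncomputable def sphDensity (z : ℂ) : ℝ := (Real.pi * (1 + ‖z‖ ^ 2) ^ 2)⁻¹

/-- The normalized area measure of the sphere, transported to `ℂ` by stereographic projection. -/
noncomputable def sph : Measure ℂ := volume.withDensity fun z => ENNReal.ofReal (sphDensity z)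

lemma sphDensity_pos (z : ℂ) : 0 < sphDensity z := by
  unfold sphDensity; positivity

lemma continuous_sphDensity : Continuous sphDensity := by
  unfold sphDensity
  refine Continuous.inv₀ (by fun_prop) fun z => by positivity

lemma measurable_ofReal_sphDensity : Measurable fun z => ENNReal.ofReal (sphDensity z) :=
  continuous_sphDensity.measurable.ennreal_ofReal

lemma integrable_sphDensity : Integrable sphDensity := by
  have h := (integrable_rpow_neg_one_add_norm_sq (E := ℂ) (μ := volume) (r := 4)
    (by rw [Complex.finrank_real_complex]; norm_num)).const_mul Real.pi⁻¹
  refine h.congr (Eventually.of_forall fun z => ?_)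
  have h0 : (0 : ℝ) ≤ 1 + ‖z‖ ^ 2 := by positivity
  simp only [sphDensity]
  rw [show (-4 / 2 : ℝ) = -(2 : ℕ) by norm_num, Real.rpow_neg h0, Real.rpow_natCast, mul_inv]

lemma integral_sph (g : ℂ → ℝ) : ∫ z, g z ∂sph = ∫ z, sphDensity z * g z := by
  rw [sph, integral_withDensity_eq_integral_toReal_smul measurable_ofReal_sphDensity
    (Eventually.of_forall fun _ => ENNReal.ofReal_lt_top)]
  simp [ENNReal.toReal_ofReal (sphDensity_pos _).le]

lemma integrable_sph_iff {g : ℂ → ℝ} :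
    Integrable g sph ↔ Integrable fun z => sphDensity z * g z := by
  rw [sph, integrable_withDensity_iff_integrable_smul' measurable_ofReal_sphDensity
    (Eventually.of_forall fun _ => ENNReal.ofReal_lt_top)]
  simp [ENNReal.toReal_ofReal (sphDensity_pos _).le]

instance : IsFiniteMeasure sph :=
  isFiniteMeasure_withDensity_ofReal integrable_sphDensity.2

lemma sph_absolutelyContinuous : sph ≪ volume := withDensity_absolutelyContinuous _ _

lemma integral_sph_polar (g : ℂ → ℝ) :
    ∫ z, g z ∂sph = ∫ p in Ioi (0 : ℝ) ×ˢ Ioo (-Real.pi) Real.pi,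
      p.1 / (Real.pi * (1 + p.1 ^ 2) ^ 2) * g (p.1 * Complex.exp (p.2 * Complex.I)) := by
  rw [integral_sph, ← Complex.integral_comp_polarCoord_symm]
  refine setIntegral_congr_fun (measurableSet_Ioi.prod measurableSet_Ioo) fun p hp => ?_
  have h : (Complex.polarCoord.symm p : ℂ) = p.1 * Complex.exp (p.2 * Complex.I) := by
    rw [Complex.polarCoord_symm_apply, Complex.exp_mul_I]; simp
  have h1 : ‖(p.1 : ℂ) * Complex.exp (p.2 * Complex.I)‖ = p.1 := by
    rw [norm_mul, Complex.norm_exp_ofReal_mul_I, mul_one, Complex.norm_real,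
      Real.norm_of_nonneg (le_of_lt hp.1)]
  simp only [h, smul_eq_mul, sphDensity, h1]
  ring

lemma integral_rpow_radial {s : ℝ} (hs : -1 < s) :
    ∫ r in Ioi (0 : ℝ), r / (Real.pi * (1 + r ^ 2) ^ 2) * (1 + r ^ 2) ^ (-s)
      = 1 / (2 * Real.pi * (s + 1)) := by
  have hpi := Real.pi_pos
  have hs' : 0 < s + 1 := by linarith
  have key : ∀ x ∈ Ioi (0 : ℝ), HasDerivAt
      (fun r : ℝ => -(1 / (2 * Real.pi * (s + 1))) * (1 + r ^ 2) ^ (-(s + 1)))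
      (x / (Real.pi * (1 + x ^ 2) ^ 2) * (1 + x ^ 2) ^ (-s)) x := by
    intro x _
    have h0 : (0 : ℝ) < 1 + x ^ 2 := by positivity
    have h1 : HasDerivAt (fun r : ℝ => 1 + r ^ 2) (2 * x) x := by
      simpa using (hasDerivAt_pow 2 x).const_add 1
    have h2 := (h1.rpow_const (p := -(s + 1)) (Or.inl h0.ne')).const_mul
      (-(1 / (2 * Real.pi * (s + 1))))
    refine h2.congr_deriv ?_
    rw [show -(s + 1) - 1 = -s + -(2 : ℕ) by push_cast; ring, Real.rpow_add h0,
      Real.rpow_neg h0.le (2 : ℕ), Real.rpow_natCast]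
    field_simp
  have hlim : Tendsto (fun r : ℝ => -(1 / (2 * Real.pi * (s + 1))) * (1 + r ^ 2) ^ (-(s + 1)))
      atTop (𝓝 (-(1 / (2 * Real.pi * (s + 1))) * 0)) := by
    refine Tendsto.const_mul _ ((tendsto_rpow_neg_atTop hs').comp ?_)
    exact tendsto_atTop_add_const_left _ _ (tendsto_pow_atTop two_ne_zero)
  have hc : ContinuousWithinAt
      (fun r : ℝ => -(1 / (2 * Real.pi * (s + 1))) * (1 + r ^ 2) ^ (-(s + 1))) (Ici 0) 0 := by
    refine (ContinuousAt.const_mul ?_ _).continuousWithinAt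
    exact ContinuousAt.rpow_const (by fun_prop) (Or.inl (by norm_num))
  rw [integral_Ioi_of_hasDerivAt_of_nonneg hc key ?_ hlim]
  · simp
  · intro x hx
    have : (0 : ℝ) < x := hx
    positivity

lemma integral_rpow_sph {s : ℝ} (hs : -1 < s) :
    ∫ z, (1 + ‖z‖ ^ 2) ^ (-s) ∂sph = 1 / (s + 1) := by
  have hpi := Real.pi_pos
  rw [integral_sph_polar]
  have h : ∀ p ∈ Ioi (0 : ℝ) ×ˢ Ioo (-Real.pi) Real.pi,
      p.1 / (Real.pi * (1 + p.1 ^ 2) ^ 2) *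
        (1 + ‖(p.1 : ℂ) * Complex.exp (p.2 * Complex.I)‖ ^ 2) ^ (-s)
      = (p.1 / (Real.pi * (1 + p.1 ^ 2) ^ 2) * (1 + p.1 ^ 2) ^ (-s)) * (fun _ : ℝ => (1 : ℝ)) p.2 := by
    intro p hp
    rw [norm_mul, Complex.norm_exp_ofReal_mul_I, mul_one, Complex.norm_real, Real.norm_eq_abs,
      sq_abs, mul_one]
  rw [setIntegral_congr_fun (measurableSet_Ioi.prod measurableSet_Ioo) h, Measure.volume_eq_prod,
    setIntegral_prod_mul
      (fun r : ℝ => r / (Real.pi * (1 + r ^ 2) ^ 2) * (1 + r ^ 2) ^ (-s)) (fun _ : ℝ => (1 : ℝ)),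
    integral_rpow_radial hs]
  have : s + 1 ≠ 0 := by linarith
  simp [Real.volume_real_Ioo_of_le (by linarith : -Real.pi ≤ Real.pi)]
  field_simp
  ring

instance : IsProbabilityMeasure sph := by
  have h := integral_rpow_sph (s := 0) (by norm_num)
  simp only [neg_zero, Real.rpow_zero, integral_const, smul_eq_mul, mul_one, zero_add, div_one] at h
  exact ⟨by
    have := (ENNReal.toReal_eq_one_iff (sph univ)).1 h
    exact this⟩

/-- The fractional linear map `z ↦ (a z + b) / (conj a - conj b z)`, a rotation of the sphere. -/
noncomputable def mob (a b z : ℂ) : ℂ := (a * z + b) / (conj a - conj b * z)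

lemma measurable_mob (a b : ℂ) : Measurable (mob a b) := by
  unfold mob; fun_prop

lemma mob_den_sq {a b z : ℂ} (h : conj a - conj b * z ≠ 0) :
    1 + ‖mob a b z‖ ^ 2
      = (‖a‖ ^ 2 + ‖b‖ ^ 2) * (1 + ‖z‖ ^ 2) / ‖conj a - conj b * z‖ ^ 2 := by
  have h' : ‖conj a - conj b * z‖ ≠ 0 := norm_ne_zero_iff.2 h
  rw [mob, norm_div, div_pow, eq_div_iff (by positivity), add_mul, div_mul_cancel₀ _ (by positivity)]
  simp only [← Complex.normSq_eq_norm_sq, Complex.normSq_apply, Complex.sub_re, Complex.mul_re,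
    Complex.sub_im, Complex.mul_im, Complex.add_re, Complex.add_im, Complex.conj_re,
    Complex.conj_im]
  ring

lemma hasDerivAt_mob {a b z : ℂ} (h : conj a - conj b * z ≠ 0) :
    HasDerivAt (mob a b) ((‖a‖ ^ 2 + ‖b‖ ^ 2 : ℝ) / (conj a - conj b * z) ^ 2) z := by
  have h1 : HasDerivAt (fun z => a * z + b) a z := by
    simpa using ((hasDerivAt_id z).const_mul a).add_const b
  have h2 : HasDerivAt (fun z => conj a - conj b * z) (-conj b) z := by
    simpa using ((hasDerivAt_id z).const_mul (conj b)).const_sub (conj a)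
  refine (h1.div h2 h).congr_deriv ?_
  congr 1
  have e1 := Complex.mul_conj' a
  have e2 := Complex.mul_conj' b
  push_cast
  rw [← e1, ← e2]; ring

lemma sq_add_sq_pos {a b : ℂ} (hab : a ≠ 0 ∨ b ≠ 0) : 0 < ‖a‖ ^ 2 + ‖b‖ ^ 2 := by
  rcases hab with h | h
  · have := norm_pos_iff.2 h; positivity
  · have := norm_pos_iff.2 h; positivity

lemma mob_inverse {a b z : ℂ} (hab : a ≠ 0 ∨ b ≠ 0) (h : conj a - conj b * z ≠ 0) :
    a + conj b * mob a b z ≠ 0 ∧ mob (conj a) (-b) (mob a b z) = z := by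
  have hD : ((‖a‖ : ℂ) ^ 2 + (‖b‖ : ℂ) ^ 2) ≠ 0 := by
    have := sq_add_sq_pos hab
    exact_mod_cast this.ne'
  have e1 := Complex.mul_conj' a
  have e2 := Complex.mul_conj' b
  have h1 : a + conj b * mob a b z = ((‖a‖ : ℂ) ^ 2 + (‖b‖ : ℂ) ^ 2) / (conj a - conj b * z) := by
    rw [← e1, ← e2, mob]; field_simp; ring
  have h2 : a + conj b * mob a b z ≠ 0 := by
    rw [h1]; exact div_ne_zero hD h
  refine ⟨h2, ?_⟩
  rw [mob]
  simp only [Complex.conj_conj, map_neg, sub_neg_eq_add, neg_mul]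
  have h3 : conj a - z * conj b ≠ 0 := by rwa [mul_comm z]
  rw [div_eq_iff h2, h1, ← e1, ← e2, mob]
  field_simp
  ring

lemma volume_pole {a b : ℂ} (hab : a ≠ 0 ∨ b ≠ 0) :
    (volume : Measure ℂ) {z | conj a - conj b * z ≠ 0}ᶜ = 0 := by
  have : {z : ℂ | conj a - conj b * z ≠ 0}ᶜ ⊆ {conj a / conj b} := by
    intro z hz
    simp only [mem_compl_iff, mem_ofPred_eq, not_not] at hz
    have hb : conj b ≠ 0 := by
      intro hb
      rw [hb, zero_mul, sub_zero] at hz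
      rcases hab with h | h
      · exact h (by simpa using hz)
      · exact h (by simpa using hb)
    rw [mem_singleton_iff, eq_div_iff hb]
    linear_combination -hz
  exact measure_mono_null this (measure_singleton _)

lemma ae_pole {a b : ℂ} (hab : a ≠ 0 ∨ b ≠ 0) : ∀ᵐ z ∂sph, conj a - conj b * z ≠ 0 :=
  sph_absolutelyContinuous.ae_le (mem_ae_iff.2 (volume_pole hab))

lemma measurePreserving_mob {a b : ℂ} (hab : a ≠ 0 ∨ b ≠ 0) :
    MeasurePreserving (mob a b) sph sph := by
  refine ⟨measurable_mob a b, Measure.ext_of_lintegral _ fun g hg => ?_⟩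
  have hab' : conj a ≠ 0 ∨ -b ≠ 0 := by simpa using hab
  have hD := sq_add_sq_pos hab
  rw [lintegral_map hg (measurable_mob a b), sph,
    lintegral_withDensity_eq_lintegral_mul _ measurable_ofReal_sphDensity
      (show Measurable fun z => g (mob a b z) from hg.comp (measurable_mob a b)),
    lintegral_withDensity_eq_lintegral_mul _ measurable_ofReal_sphDensity hg]
  set s : Set ℂ := {z | conj a - conj b * z ≠ 0} with hs
  have hsm : MeasurableSet s := by
    have : IsOpen s := isOpen_ne_fun (by fun_prop) (by fun_prop)
    exact this.measurableSet
  have him : mob a b '' s = {z | conj (conj a) - conj (-b) * z ≠ 0} := by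
    ext w
    constructor
    · rintro ⟨z, hz, rfl⟩
      simpa using (mob_inverse hab hz).1
    · intro hw
      have := mob_inverse hab' hw
      simp only [Complex.conj_conj, neg_neg, map_neg] at this
      exact ⟨_, by simpa [hs, sub_eq_add_neg] using this.1, this.2⟩
  have hinj : InjOn (mob a b) s := by
    intro z hz w hw h
    rw [← (mob_inverse hab hz).2, h, (mob_inverse hab hw).2]
  have hcov := lintegral_image_eq_lintegral_abs_det_fderiv_mul volume hsm
    (fun z hz => ((hasDerivAt_mob hz).hasFDerivAt.restrictScalars ℝ).hasFDerivWithinAt) hinj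
    (fun z => ENNReal.ofReal (sphDensity z) * g z)
  have r1 : (volume : Measure ℂ).restrict (mob a b '' s) = volume := by
    rw [him]; exact Measure.restrict_eq_self_of_ae_mem (mem_ae_iff.2 (volume_pole hab'))
  have r2 : (volume : Measure ℂ).restrict s = volume :=
    Measure.restrict_eq_self_of_ae_mem (mem_ae_iff.2 (volume_pole hab))
  rw [r1] at hcov
  simp only [Pi.mul_apply]
  rw [hcov]
  conv_lhs => rw [← r2]
  refine setLIntegral_congr_fun hsm fun z hz => ?_
  have hz' : 0 < ‖conj a - conj b * z‖ := norm_pos_iff.2 hz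
  rw [← mul_assoc, ← ENNReal.ofReal_mul (abs_nonneg _)]
  congr 2
  have hdet : ((ContinuousLinearMap.restrictScalars ℝ (ContinuousLinearMap.toSpanSingleton ℂ
      (((‖a‖ ^ 2 + ‖b‖ ^ 2 : ℝ) : ℂ) / (conj a - conj b * z) ^ 2)))).det
      = ((‖a‖ ^ 2 + ‖b‖ ^ 2) / ‖conj a - conj b * z‖ ^ 2) ^ 2 := by
    simp [ContinuousLinearMap.det, LinearMap.det_restrictScalars, Algebra.norm_complex_apply,
      Complex.normSq_eq_norm_sq]
    norm_cast
    rw [Real.norm_of_nonneg hD.le]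
    ring
  rw [hdet, abs_of_nonneg (by positivity), sphDensity, sphDensity, mob_den_sq hz]
  field_simp

lemma integral_mob {a b : ℂ} (hab : a ≠ 0 ∨ b ≠ 0) {g : ℂ → ℝ} (hg : Measurable g) :
    ∫ z, g (mob a b z) ∂sph = ∫ z, g z ∂sph := by
  have h := measurePreserving_mob hab
  conv_rhs => rw [← h.map_eq]
  exact (integral_map (measurable_mob a b).aemeasurable hg.aestronglyMeasurable).symm

lemma integrable_norm_sph : Integrable (fun z : ℂ => ‖z‖) sph := by
  rw [integrable_sph_iff]
  have h := (integrable_rpow_neg_one_add_norm_sq (E := ℂ) (μ := volume) (r := 3)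
    (by rw [Complex.finrank_real_complex]; norm_num)).const_mul Real.pi⁻¹
  refine h.mono' (continuous_sphDensity.mul continuous_norm).aestronglyMeasurable
    (Eventually.of_forall fun z => ?_)
  have h0 : (0 : ℝ) < 1 + ‖z‖ ^ 2 := by positivity
  rw [Real.norm_of_nonneg (mul_nonneg (sphDensity_pos z).le (norm_nonneg z)),
    show (-3 / 2 : ℝ) = (1 / 2 : ℝ) + -(2 : ℕ) by norm_num, Real.rpow_add h0,
    Real.rpow_neg h0.le, Real.rpow_natCast, ← Real.sqrt_eq_rpow, sphDensity, mul_inv]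
  have h1 : ‖z‖ ≤ √(1 + ‖z‖ ^ 2) := Real.le_sqrt_of_sq_le (by linarith)
  have h2 : (0 : ℝ) ≤ ((1 + ‖z‖ ^ 2) ^ 2)⁻¹ := by positivity
  have h3 : (0 : ℝ) ≤ Real.pi⁻¹ := by positivity
  calc Real.pi⁻¹ * ((1 + ‖z‖ ^ 2) ^ 2)⁻¹ * ‖z‖
      ≤ Real.pi⁻¹ * ((1 + ‖z‖ ^ 2) ^ 2)⁻¹ * √(1 + ‖z‖ ^ 2) := by gcongr
    _ = _ := by ring

lemma integrable_norm_mob {a b : ℂ} (hab : a ≠ 0 ∨ b ≠ 0) :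
    Integrable (fun z => ‖mob a b z‖) sph :=
  (measurePreserving_mob hab).integrable_comp_of_integrable integrable_norm_sph

lemma integrable_re_mob {a b : ℂ} (hab : a ≠ 0 ∨ b ≠ 0) :
    Integrable (fun z => (mob a b z).re) sph :=
  (integrable_norm_mob hab).mono' (Complex.measurable_re.comp (measurable_mob a b)).aestronglyMeasurable
    (Eventually.of_forall fun _ => Complex.abs_re_le_norm _)

lemma integral_inv_sq_add_sq {A : ℝ} (hA : 1 ≤ A) :
    ∫ b : ℝ, (Real.pi * (A + b ^ 2) ^ 2)⁻¹ = 1 / (2 * A * √A) := by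
  have hpi := Real.pi_pos
  have hA0 : 0 < A := by linarith
  have hs : 0 < √A := Real.sqrt_pos.2 hA0
  have hss : √A ^ 2 = A := Real.sq_sqrt hA0.le
  have key : ∀ x : ℝ, HasDerivAt (fun b : ℝ => (2 * Real.pi)⁻¹ * (b / (A * (A + b ^ 2)) +
      Real.arctan (b / √A) / (A * √A))) ((Real.pi * (A + x ^ 2) ^ 2)⁻¹) x := by
    intro x
    have h0 : 0 < A + x ^ 2 := by positivity
    have h1 : HasDerivAt (fun b : ℝ => A * (A + b ^ 2)) (A * (2 * x)) x := by
      simpa using ((hasDerivAt_pow 2 x).const_add A).const_mul A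
    have h2 := (hasDerivAt_id x).div h1 (by positivity)
    have h3 := (((hasDerivAt_id x).div_const (√A)).arctan).div_const (A * √A)
    refine ((h2.add h3).const_mul _).congr_deriv ?_
    simp only [id]
    have h4 : 1 + (x / √A) ^ 2 = (A + x ^ 2) / A := by
      rw [div_pow, hss]; field_simp
    rw [h4]
    field_simp
    rw [hss]; ring
  have hint : Integrable fun b : ℝ => (Real.pi * (A + b ^ 2) ^ 2)⁻¹ := by
    refine integrable_inv_one_add_sq.mono' (by fun_prop) (Eventually.of_forall fun b => ?_)
    rw [Real.norm_of_nonneg (by positivity)]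
    refine inv_anti₀ (by positivity) ?_
    have := Real.pi_gt_three
    nlinarith [sq_nonneg b, sq_nonneg (A + b ^ 2 - 1), mul_nonneg (by linarith : 0 ≤ Real.pi - 3) (sq_nonneg (A + b ^ 2))]
  have hfrac : ∀ l : Filter ℝ, Tendsto (fun b : ℝ => |b|) l atTop →
      Tendsto (fun b : ℝ => b / (A * (A + b ^ 2))) l (𝓝 0) := by
    intro l hl
    rw [tendsto_zero_iff_abs_tendsto_zero]
    refine squeeze_zero (fun _ => abs_nonneg _) (fun b => ?_) (tendsto_inv_atTop_zero.comp hl)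
    simp only [Function.comp]
    rw [abs_div, abs_of_pos (by positivity : 0 < A * (A + b ^ 2))]
    rcases eq_or_ne b 0 with rfl | hb
    · simp
    have hb' : 0 < |b| := abs_pos.2 hb
    rw [div_le_iff₀ (by positivity), ← sq_abs b]
    field_simp
    nlinarith [sq_nonneg |b|]
  have hdiv : Tendsto (fun b : ℝ => b / √A) atTop atTop := tendsto_id.atTop_div_const hs
  have hdiv' : Tendsto (fun b : ℝ => b / √A) atBot atBot := tendsto_id.atBot_div_const hs
  have ht : Tendsto (fun b : ℝ => (2 * Real.pi)⁻¹ * (b / (A * (A + b ^ 2)) +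
      Real.arctan (b / √A) / (A * √A))) atTop
      (𝓝 ((2 * Real.pi)⁻¹ * (0 + (Real.pi / 2) / (A * √A)))) :=
    (((hfrac _ tendsto_abs_atTop_atTop).add
      (((tendsto_nhds_of_tendsto_nhdsWithin Real.tendsto_arctan_atTop).comp hdiv).div_const _))).const_mul _
  have hb : Tendsto (fun b : ℝ => (2 * Real.pi)⁻¹ * (b / (A * (A + b ^ 2)) +
      Real.arctan (b / √A) / (A * √A))) atBot
      (𝓝 ((2 * Real.pi)⁻¹ * (0 + (-(Real.pi / 2)) / (A * √A)))) :=
    (((hfrac _ tendsto_abs_atBot_atTop).add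
      (((tendsto_nhds_of_tendsto_nhdsWithin Real.tendsto_arctan_atBot).comp hdiv').div_const _))).const_mul _
  rw [integral_of_hasDerivAt_of_tendsto key hint hb ht]
  field_simp
  ring

lemma integral_tail (c : ℝ) :
    ∫ a in Ioi c, (a - c) * (1 / (2 * (1 + a ^ 2) * √(1 + a ^ 2))) = (√(1 + c ^ 2) - c) / 2 := by
  have key : ∀ x ∈ Ioi c, HasDerivAt (fun a : ℝ => -(1 / 2) * ((1 + c * a) / √(1 + a ^ 2)))
      ((x - c) * (1 / (2 * (1 + x ^ 2) * √(1 + x ^ 2)))) x := by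
    intro x _
    have h0 : (0 : ℝ) < 1 + x ^ 2 := by positivity
    have hs : 0 < √(1 + x ^ 2) := Real.sqrt_pos.2 h0
    have hss : √(1 + x ^ 2) ^ 2 = 1 + x ^ 2 := Real.sq_sqrt h0.le
    have h1 : HasDerivAt (fun r : ℝ => 1 + r ^ 2) (2 * x) x := by
      simpa using (hasDerivAt_pow 2 x).const_add 1
    have h2 : HasDerivAt (fun a : ℝ => 1 + c * a) c x := by
      simpa using ((hasDerivAt_id x).const_mul c).const_add 1
    refine ((h2.div (h1.sqrt h0.ne') hs.ne').const_mul _).congr_deriv ?_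
    rw [hss]
    field_simp
    rw [hss]; ring
  have hroot : Tendsto (fun a : ℝ => √(1 + a ^ 2)) atTop atTop :=
    Real.tendsto_sqrt_atTop.comp
      (tendsto_atTop_add_const_left _ _ (tendsto_pow_atTop two_ne_zero))
  have hone : Tendsto (fun a : ℝ => a / √(1 + a ^ 2)) atTop (𝓝 1) := by
    have h1 : Tendsto (fun a : ℝ => √(1 - (1 + a ^ 2)⁻¹)) atTop (𝓝 (√(1 - 0))) :=
      ((tendsto_inv_atTop_zero.comp (tendsto_atTop_add_const_left _ (1 : ℝ)
        (tendsto_pow_atTop two_ne_zero))).const_sub 1).sqrt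
    rw [sub_zero, Real.sqrt_one] at h1
    refine h1.congr' ?_
    filter_upwards [eventually_gt_atTop 0] with a ha
    have h0 : (0 : ℝ) < 1 + a ^ 2 := by positivity
    rw [show 1 - (1 + a ^ 2)⁻¹ = a ^ 2 / (1 + a ^ 2) by field_simp; ring,
      Real.sqrt_div (sq_nonneg a), Real.sqrt_sq ha.le]
  have hlim : Tendsto (fun a : ℝ => -(1 / 2) * ((1 + c * a) / √(1 + a ^ 2))) atTop
      (𝓝 (-(1 / 2) * (0 + c * 1))) := by
    refine Tendsto.const_mul _ ?_
    have := (tendsto_inv_atTop_zero.comp hroot).add (hone.const_mul c)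
    refine this.congr fun a => ?_
    simp only [Function.comp]
    ring
  have hc : ContinuousWithinAt (fun a : ℝ => -(1 / 2) * ((1 + c * a) / √(1 + a ^ 2))) (Ici c) c := by
    refine ContinuousAt.continuousWithinAt (ContinuousAt.const_mul ?_ _)
    refine ContinuousAt.div (by fun_prop) (by fun_prop) ?_
    exact (Real.sqrt_pos.2 (by positivity)).ne'
  rw [integral_Ioi_of_hasDerivAt_of_nonneg hc key ?_ hlim]
  · have h0 : (0 : ℝ) < 1 + c ^ 2 := by positivity
    have hs : 0 < √(1 + c ^ 2) := Real.sqrt_pos.2 h0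
    have hss : √(1 + c ^ 2) ^ 2 = 1 + c ^ 2 := Real.sq_sqrt h0.le
    field_simp
    linear_combination -hss
  · intro x hx
    have : 0 ≤ x - c := sub_nonneg.2 (le_of_lt hx)
    positivity

lemma integral_max_re_sub (c : ℝ) :
    ∫ z : ℂ, max (z.re - c) 0 ∂sph = (√(1 + c ^ 2) - c) / 2 := by
  have hint : Integrable (fun z : ℂ => max (z.re - c) 0) sph := by
    refine Integrable.sup ?_ (integrable_zero _ _ _)
    refine Integrable.sub ?_ (integrable_const c)
    exact integrable_norm_sph.mono' Complex.measurable_re.aestronglyMeasurable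
      (Eventually.of_forall fun _ => Complex.abs_re_le_norm _)
  rw [integrable_sph_iff] at hint
  have hvp := Complex.volume_preserving_equiv_real_prod.symm
  rw [integral_sph, ← hvp.integral_comp' (g := fun z : ℂ => sphDensity z * max (z.re - c) 0)]
  have hint2 := (hvp.integrable_comp_emb Complex.measurableEquivRealProd.symm.measurableEmbedding).2 hint
  rw [Measure.volume_eq_prod] at hint2 ⊢
  have hfub := integral_prod _ hint2
  simp only [Function.comp] at hfub
  rw [hfub]
  have h1 : ∀ a : ℝ, ∫ b : ℝ, sphDensity (Complex.measurableEquivRealProd.symm (a, b)) *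
      max ((Complex.measurableEquivRealProd.symm (a, b)).re - c) 0
      = (Ioi c).indicator (fun a => (a - c) * (1 / (2 * (1 + a ^ 2) * √(1 + a ^ 2)))) a := by
    intro a
    have h2 : ∀ b : ℝ, sphDensity (Complex.measurableEquivRealProd.symm (a, b)) *
      max ((Complex.measurableEquivRealProd.symm (a, b)).re - c) 0
      = (Real.pi * ((1 + a ^ 2) + b ^ 2) ^ 2)⁻¹ * max (a - c) 0 := by
      intro b
      have h3 : Complex.measurableEquivRealProd.symm (a, b) = ⟨a, b⟩ := rfl
      rw [h3, sphDensity, ← Complex.normSq_eq_norm_sq, Complex.normSq_mk]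
      ring_nf
    simp_rw [h2]
    rw [integral_mul_const, integral_inv_sq_add_sq (by nlinarith [sq_nonneg a])]
    by_cases hac : c < a
    · rw [indicator_of_mem (show a ∈ Ioi c from hac), max_eq_left (by linarith)]; ring
    · rw [indicator_of_notMem (show a ∉ Ioi c from hac), max_eq_right (by linarith), mul_zero]
  simp_rw [h1]
  rw [integral_indicator measurableSet_Ioi, integral_tail]

lemma setIntegral_re_mob_le {a b : ℂ} (hab : a ≠ 0 ∨ b ≠ 0) {s : Set ℂ}
    (h0 : 0 < sph.real s) (h1 : sph.real s < 1) :
    ∫ x in s, (mob a b x).re ∂sph ≤ √(sph.real s * (1 - sph.real s)) := by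
  set m := sph.real s with hm
  set R := √(m * (1 - m)) with hR
  have hmm : 0 < m * (1 - m) := mul_pos h0 (by linarith)
  have hR0 : 0 < R := Real.sqrt_pos.2 hmm
  have hRR : R ^ 2 = m * (1 - m) := Real.sq_sqrt hmm.le
  set c := (1 - 2 * m) / (2 * R) with hc
  have hint := integrable_re_mob hab
  have hmax : Integrable (fun x => max ((mob a b x).re - c) 0) sph :=
    (hint.sub (integrable_const c)).sup (integrable_zero _ _ _)
  have e1 : ∫ x in s, ((mob a b x).re - c) ∂sph ≤ ∫ x, max ((mob a b x).re - c) 0 ∂sph :=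
    calc _ ≤ ∫ x in s, max ((mob a b x).re - c) 0 ∂sph :=
          setIntegral_mono (hint.sub (integrable_const c)).integrableOn hmax.integrableOn
            fun x => le_max_left _ _
      _ ≤ _ := setIntegral_le_integral hmax (Eventually.of_forall fun x => le_max_right _ _)
  rw [integral_mob hab (g := fun z => max (z.re - c) 0) (by fun_prop), integral_max_re_sub,
    integral_sub hint.integrableOn (integrable_const c).integrableOn, setIntegral_const,
    smul_eq_mul, ← hm] at e1
  have hsq : √(1 + c ^ 2) = 1 / (2 * R) := by
    rw [Real.sqrt_eq_iff_mul_self_eq (by positivity) (by positivity), hc]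
    field_simp
    rw [hRR]; ring
  rw [hsq] at e1
  have e2 : m * c + (1 / (2 * R) - c) / 2 = R := by
    rw [hc]; field_simp; rw [hRR]; ring
  linarith

/-- The spherical isoperimetric bound for the normalized Green kernel, by rearrangement. -/
lemma setIntegral_re_mul_mob_le {a b : ℂ} (hab : a ≠ 0 ∨ b ≠ 0) (e : ℂ) {s : Set ℂ}
    (h0 : 0 < sph.real s) (h1 : sph.real s < 1) :
    ∫ x in s, (e * mob a b x).re ∂sph ≤ ‖e‖ * √(sph.real s * (1 - sph.real s)) := by
  set l : ℂ := Complex.exp ((e.arg / 2 : ℝ) * Complex.I) with hl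
  have hl0 : l ≠ 0 := Complex.exp_ne_zero _
  have hll : e = ‖e‖ * (l * l) := by
    rw [hl, ← Complex.exp_add, ← add_mul]
    push_cast
    rw [add_halves, Complex.norm_mul_exp_arg_mul_I]
  have hcl : conj l * l = 1 := by
    rw [Complex.conj_mul', hl, Complex.norm_exp_ofReal_mul_I]; simp
  have hab' : l * a ≠ 0 ∨ l * b ≠ 0 := hab.imp (mul_ne_zero hl0) (mul_ne_zero hl0)
  have h : ∀ x, (e * mob a b x).re = ‖e‖ * (mob (l * a) (l * b) x).re := by
    intro x
    have hm : mob (l * a) (l * b) x = l * l * mob a b x := by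
      have hcl0 : conj l ≠ 0 := by simpa using hl0
      rw [mob, mob, map_mul, map_mul, show l * a * x + l * b = l * (a * x + b) by ring,
        show conj l * conj a - conj l * conj b * x = conj l * (conj a - conj b * x) by ring,
        mul_div_mul_comm, show l / conj l = l * l by rw [div_eq_iff hcl0]; linear_combination -l * hcl]
    rw [hm]
    conv_lhs => rw [hll, mul_assoc]
    rw [Complex.re_ofReal_mul]
  simp_rw [h]
  rw [integral_const_mul]
  exact mul_le_mul_of_nonneg_left (setIntegral_re_mob_le hab' h0 h1) (norm_nonneg e)

/-- The real differential `c ↦ 2 Re (e c)` of a real function whose holomorphic derivative is `e`. -/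
noncomputable def reDer (e : ℂ) : ℂ →L[ℝ] ℝ :=
  (2 : ℝ) • Complex.reCLM.comp (ContinuousLinearMap.mul ℝ ℂ e)

lemma reDer_apply (e c : ℂ) : reDer e c = 2 * (e * c).re := rfl

lemma measurable_mob_left (x : ℂ) : Measurable fun y => mob (conj y) 1 x := by
  unfold mob
  have : Measurable (fun y : ℂ => conj y) := Complex.continuous_conj.measurable
  simp only [Complex.conj_conj]
  fun_prop

lemma green_kernel_mob {x z : ℂ} (hz : z ≠ 0) (h : 1 - conj x * z ≠ 0) :
    ((1 + ‖mob 1 x z‖ ^ 2 : ℝ) : ℂ) * conj (mob (conj (mob 1 x z)) 1 x) =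
      ((‖(1 : ℂ)‖ ^ 2 + ‖x‖ ^ 2 : ℝ) : ℂ) / (1 - conj x * z) ^ 2 * ((1 + ‖z‖ ^ 2 : ℝ) / conj z) := by
  have h' : conj (1 : ℂ) - conj x * z ≠ 0 := by simpa using h
  have hc : 1 - x * conj z ≠ 0 := by
    intro h0; apply h
    have := congrArg conj h0
    simpa using this
  have hzc : conj z ≠ 0 := by simpa using hz
  have hx : (1 + x * conj x : ℂ) ≠ 0 := by
    rw [Complex.mul_conj']; norm_cast; positivity
  rw [mob_den_sq h']
  have e1 : conj (mob (conj (mob 1 x z)) 1 x) = (1 - x * conj z) / (conj z * (1 - conj x * z)) := by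
    have hm : mob 1 x z = (z + x) / (1 - conj x * z) := by simp [mob]
    have hd : conj (mob 1 x z) - conj x = conj z * (1 + x * conj x) / (1 - x * conj z) := by
      rw [hm]; simp only [map_div₀, map_add, map_sub, map_mul, map_one, Complex.conj_conj]
      rw [div_sub' hc]; ring
    have hn : mob 1 x z * conj x + 1 = (1 + x * conj x) / (1 - conj x * z) := by
      rw [hm, div_mul_eq_mul_div, div_add_one h]; ring
    rw [mob]
    simp only [map_div₀, map_add, map_sub, map_mul, map_one, Complex.conj_conj, one_mul]
    rw [hn, hd]
    field_simp
  rw [e1]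
  have hd2 : ((‖conj (1 : ℂ) - conj x * z‖ : ℝ) : ℂ) ^ 2 = (1 - conj x * z) * (1 - x * conj z) := by
    rw [← Complex.mul_conj']; simp
  push_cast
  rw [hd2]
  field_simp

lemma hasDerivAt_ray {G : ℂ → ℝ} {E : ℂ → ℂ} (hG : ∀ y, HasFDerivAt G (reDer (E y)) y)
    {x u : ℂ} (hu : ‖u‖ = 1) {r : ℝ} (hr : 0 < r) (h : 1 - conj x * (r * u) ≠ 0) :
    HasDerivAt (fun r : ℝ => -(G (mob 1 x (r * u)) / (2 * Real.pi * (1 + r ^ 2))))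
      (r / (Real.pi * (1 + r ^ 2) ^ 2) * (G (mob 1 x (r * u)) -
        (1 + ‖mob 1 x (r * u)‖ ^ 2) *
          (E (mob 1 x (r * u)) * conj (mob (conj (mob 1 x (r * u))) 1 x)).re)) r := by
  have hpi := Real.pi_pos
  have hz : (r : ℂ) * u ≠ 0 := by
    rw [← norm_pos_iff, norm_mul, hu, mul_one, Complex.norm_real, Real.norm_eq_abs]; positivity
  have hnz : ‖(r : ℂ) * u‖ = r := by
    rw [norm_mul, hu, mul_one, Complex.norm_real, Real.norm_eq_abs, abs_of_pos hr]
  have h' : conj (1 : ℂ) - conj x * (r * u) ≠ 0 := by simpa using h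
  have d0 : HasDerivAt (fun r : ℝ => (r : ℂ) * u) u r := by
    simpa using (Complex.ofRealCLM.hasDerivAt (x := r)).mul_const u
  have d1 : HasDerivAt (fun r : ℝ => mob 1 x (r * u)) _ r :=
    HasDerivAt.comp (h := fun r : ℝ => (r : ℂ) * u) r (hasDerivAt_mob h') d0
  have d2 : HasDerivAt (fun r : ℝ => G (mob 1 x (r * u))) _ r := (hG _).comp_hasDerivAt r d1
  have d3 : HasDerivAt (fun r : ℝ => 2 * Real.pi * (1 + r ^ 2)) (2 * Real.pi * (2 * r)) r := by
    simpa using ((hasDerivAt_pow 2 r).const_add 1).const_mul (2 * Real.pi)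
  refine (d2.div d3 (by positivity)).neg.congr_deriv ?_
  have key := green_kernel_mob hz h
  have hu2 : (r : ℂ) / conj ((r : ℂ) * u) = u := by
    have : conj u * u = 1 := by rw [Complex.conj_mul', hu]; simp
    have hr' : (r : ℂ) ≠ 0 := by exact_mod_cast hr.ne'
    rw [map_mul, Complex.conj_ofReal]
    have hcu : conj u ≠ 0 := left_ne_zero_of_mul_eq_one this
    field_simp
    linear_combination -this
  have e : (1 + ‖mob 1 x (r * u)‖ ^ 2) *
      (E (mob 1 x (r * u)) * conj (mob (conj (mob 1 x (r * u))) 1 x)).re =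
      (1 + r ^ 2) / r * (E (mob 1 x (r * u)) *
        (((‖(1 : ℂ)‖ ^ 2 + ‖x‖ ^ 2 : ℝ) : ℂ) / (1 - conj x * (r * u)) ^ 2 * u)).re := by
    rw [← Complex.re_ofReal_mul, ← Complex.re_ofReal_mul, mul_left_comm, key, hnz]
    have hr' : (r : ℂ) ≠ 0 := by exact_mod_cast hr.ne'
    have hu3 : ((1 + r ^ 2 : ℝ) : ℂ) / conj ((r : ℂ) * u) = ((1 + r ^ 2 : ℝ) : ℂ) / r * u := by
      conv_rhs => rw [← hu2]
      field_simp
    rw [hu3]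
    congr 1
    push_cast
    ring
  rw [e, reDer_apply, map_one]
  field_simp
  ring

lemma norm_green_le {x z : ℂ} (hz : z ≠ 0) (h : 1 - conj x * z ≠ 0) :
    ‖mob (conj (mob 1 x z)) 1 x‖ = ‖z‖⁻¹ := by
  have h' : conj (1 : ℂ) - conj x * z ≠ 0 := by simpa using h
  have := congrArg norm (green_kernel_mob hz h)
  rw [norm_mul, norm_mul, Complex.norm_conj, Complex.norm_real, norm_div, norm_div, norm_pow,
    Complex.norm_real, Complex.norm_real, Complex.norm_conj,
    Real.norm_of_nonneg (by positivity), Real.norm_of_nonneg (by positivity),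
    Real.norm_of_nonneg (by positivity), mob_den_sq h', map_one] at this
  have h1 : 0 < ‖1 - conj x * z‖ := norm_pos_iff.2 h
  have h2 : 0 < ‖(1 : ℂ)‖ ^ 2 + ‖x‖ ^ 2 := by
    rw [norm_one]; positivity
  have h3 : 0 < 1 + ‖z‖ ^ 2 := by positivity
  have h4 : 0 < ‖z‖ := norm_pos_iff.2 hz
  field_simp at this ⊢
  exact this

/-- Green's representation on the sphere, integrated along the geodesics leaving `x`. -/
theorem green_representation {G : ℂ → ℝ} {E : ℂ → ℂ} (hG : ∀ y, HasFDerivAt G (reDer (E y)) y)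
    (hE : Measurable E) {A C : ℝ} (hA : ∀ y, |G y| ≤ A) (hC : ∀ y, (1 + ‖y‖ ^ 2) * ‖E y‖ ≤ C)
    (x : ℂ) :
    ∫ y, (G y - (1 + ‖y‖ ^ 2) * (E y * conj (mob (conj y) 1 x)).re) ∂sph = G x := by
  have hpi := Real.pi_pos
  have hGm : Measurable G := (continuous_iff_continuousAt.2 fun y => (hG y).continuousAt).measurable
  have hA0 : 0 ≤ A := (abs_nonneg _).trans (hA 0)
  have hC0 : 0 ≤ C := le_trans (by positivity) (hC 0)
  set I : ℂ → ℝ := fun y => G y - (1 + ‖y‖ ^ 2) * (E y * conj (mob (conj y) 1 x)).re with hI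
  have hκ := measurable_mob_left x
  have hconj : Measurable (fun y : ℂ => conj y) := Complex.continuous_conj.measurable
  have hIm : Measurable I := by
    refine hGm.sub ((by fun_prop : Measurable fun y : ℂ => 1 + ‖y‖ ^ 2).mul ?_)
    exact Complex.measurable_re.comp (hE.mul (hconj.comp hκ))
  set H : ℝ × ℝ → ℝ := fun p => p.1 / (Real.pi * (1 + p.1 ^ 2) ^ 2) *
    I (mob 1 x (p.1 * Complex.exp (p.2 * Complex.I))) with hH
  have hHm : Measurable H := by
    refine Measurable.mul (by fun_prop) (hIm.comp ((measurable_mob 1 x).comp (by fun_prop)))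
  have hpole : ∀ θ ∈ Ioo (-Real.pi) Real.pi, θ ≠ x.arg → ∀ r : ℝ, 0 < r →
      1 - conj x * (r * Complex.exp (θ * Complex.I)) ≠ 0 := by
    intro θ hθ hne r hr h0
    apply hne
    have h1 : conj x * (r * Complex.exp (θ * Complex.I)) = 1 := (sub_eq_zero.1 h0).symm
    have hx0 : conj x ≠ 0 := left_ne_zero_of_mul_eq_one h1
    have h2 : x = (‖x‖ ^ 2 * r : ℝ) * (Complex.cos θ + Complex.sin θ * Complex.I) := by
      rw [← Complex.exp_mul_I]
      push_cast
      rw [← Complex.mul_conj']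
      linear_combination -x * h1
    have hx : x ≠ 0 := by simpa using hx0
    have hpos : 0 < ‖x‖ ^ 2 * r := by positivity
    rw [h2, Complex.arg_mul_cos_add_sin_mul_I hpos (Ioo_subset_Ioc_self hθ)]
  have hbound : ∀ r : ℝ, 0 < r → ∀ θ ∈ Ioo (-Real.pi) Real.pi, θ ≠ x.arg →
      ‖H (r, θ)‖ ≤ (A + C) * (1 + r ^ 2)⁻¹ := by
    intro r hr θ hθ hne
    have h := hpole θ hθ hne r hr
    have hnz : ‖(r : ℂ) * Complex.exp (θ * Complex.I)‖ = r := by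
      rw [norm_mul, Complex.norm_exp_ofReal_mul_I, mul_one, Complex.norm_real, Real.norm_eq_abs,
        abs_of_pos hr]
    have hz : (r : ℂ) * Complex.exp (θ * Complex.I) ≠ 0 := by
      rw [← norm_pos_iff, hnz]; exact hr
    set y := mob 1 x (r * Complex.exp (θ * Complex.I)) with hy
    have h1 : |I y| ≤ A + C / r := by
      refine (abs_sub _ _).trans (add_le_add (hA y) ?_)
      rw [abs_mul, abs_of_pos (by positivity : 0 < 1 + ‖y‖ ^ 2)]
      calc (1 + ‖y‖ ^ 2) * |(E y * conj (mob (conj y) 1 x)).re|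
          ≤ (1 + ‖y‖ ^ 2) * ‖E y * conj (mob (conj y) 1 x)‖ := by
            gcongr; exact Complex.abs_re_le_norm _
        _ = ((1 + ‖y‖ ^ 2) * ‖E y‖) / r := by
            rw [norm_mul, Complex.norm_conj, hy, norm_green_le hz h, hnz]; ring
        _ ≤ C / r := by gcongr; exact hC y
    rw [hH, Real.norm_eq_abs, abs_mul, abs_of_pos (by positivity)]
    calc r / (Real.pi * (1 + r ^ 2) ^ 2) * |I y|
        ≤ r / (Real.pi * (1 + r ^ 2) ^ 2) * (A + C / r) := by gcongr
      _ ≤ (A + C) * (1 + r ^ 2)⁻¹ := by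
          have h3 := Real.pi_gt_three
          have e : r / (Real.pi * (1 + r ^ 2) ^ 2) * (A + C / r) =
            (A * r + C) / (Real.pi * (1 + r ^ 2)) * (1 + r ^ 2)⁻¹ := by field_simp
          rw [e]
          refine mul_le_mul_of_nonneg_right ?_ (by positivity)
          rw [div_le_iff₀ (by positivity)]
          have h4 : r ≤ 3 * (1 + r ^ 2) := by nlinarith [sq_nonneg (r - 1)]
          have h5 : 1 ≤ 3 * (1 + r ^ 2) := by nlinarith
          have h6 : 3 * (1 + r ^ 2) ≤ Real.pi * (1 + r ^ 2) := by gcongr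
          nlinarith
  have hae : ∀ᵐ θ ∂(volume.restrict (Ioo (-Real.pi) Real.pi)), θ ≠ x.arg :=
    ae_restrict_of_ae (Measure.ae_ne volume _)
  have hrad : IntegrableOn (fun r : ℝ => (A + C) * (1 + r ^ 2)⁻¹) (Ioi 0) :=
    (integrable_inv_one_add_sq.const_mul _).integrableOn
  have hinner : ∀ θ ∈ Ioo (-Real.pi) Real.pi, θ ≠ x.arg →
      ∫ r in Ioi (0 : ℝ), H (r, θ) = G x / (2 * Real.pi) := by
    intro θ hθ hne
    have hu : ‖Complex.exp (θ * Complex.I)‖ = 1 := Complex.norm_exp_ofReal_mul_I θ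
    have hint : IntegrableOn (fun r => H (r, θ)) (Ioi 0) := by
      refine hrad.mono' (hHm.comp (by fun_prop)).aestronglyMeasurable ?_
      filter_upwards [ae_restrict_mem measurableSet_Ioi] with r hr
      exact hbound r hr θ hθ hne
    have hlim : Tendsto (fun r : ℝ => -(G (mob 1 x (r * Complex.exp (θ * Complex.I))) /
        (2 * Real.pi * (1 + r ^ 2)))) atTop (𝓝 0) := by
      rw [tendsto_zero_iff_abs_tendsto_zero]
      refine squeeze_zero (fun _ => abs_nonneg _) (g := fun r : ℝ => A * (1 + r ^ 2)⁻¹)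
        (fun r => ?_) ?_
      · simp only [Function.comp]
        rw [abs_neg, abs_div, abs_of_pos (by positivity : 0 < 2 * Real.pi * (1 + r ^ 2)),
          div_eq_mul_inv]
        have h3 := Real.pi_gt_three
        have : (2 * Real.pi * (1 + r ^ 2))⁻¹ ≤ (1 + r ^ 2)⁻¹ :=
          inv_anti₀ (by positivity) (by nlinarith [sq_nonneg r])
        exact mul_le_mul (hA _) this (by positivity) hA0
      · have := (tendsto_inv_atTop_zero.comp (tendsto_atTop_add_const_left _ (1 : ℝ)
          (tendsto_pow_atTop (α := ℝ) two_ne_zero))).const_mul A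
        simpa using this
    have hcont : ContinuousWithinAt (fun r : ℝ =>
        -(G (mob 1 x (r * Complex.exp (θ * Complex.I))) / (2 * Real.pi * (1 + r ^ 2)))) (Ici 0) 0 := by
      refine ContinuousAt.continuousWithinAt (ContinuousAt.neg (ContinuousAt.div ?_ (by fun_prop)
        (by positivity)))
      have h0 : conj (1 : ℂ) - conj x * (((0 : ℝ) : ℂ) * Complex.exp (θ * Complex.I)) ≠ 0 := by simp
      have c1 : ContinuousAt (fun r : ℝ => mob 1 x (r * Complex.exp (θ * Complex.I))) 0 :=
        ContinuousAt.comp (f := fun r : ℝ => (r : ℂ) * Complex.exp (θ * Complex.I))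
          (hasDerivAt_mob h0).continuousAt (by fun_prop)
      exact ContinuousAt.comp (f := fun r : ℝ => mob 1 x (r * Complex.exp (θ * Complex.I)))
        (hG _).continuousAt c1
    rw [integral_Ioi_of_hasDerivAt_of_tendsto hcont
      (fun r hr => hasDerivAt_ray hG hu hr (hpole θ hθ hne r hr)) hint hlim]
    simp [mob]
  have hHint : Integrable H ((volume.restrict (Ioi 0)).prod
      (volume.restrict (Ioo (-Real.pi) Real.pi))) := by
    refine Integrable.mono' (g := fun p : ℝ × ℝ => (A + C) * (1 + p.1 ^ 2)⁻¹ * 1)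
      (hrad.mul_prod (integrable_const (1 : ℝ))) hHm.aestronglyMeasurable ?_
    have h1 := Measure.quasiMeasurePreserving_fst (μ := (volume : Measure ℝ).restrict (Ioi 0))
      (ν := (volume : Measure ℝ).restrict (Ioo (-Real.pi) Real.pi)) |>.ae
        (ae_restrict_mem measurableSet_Ioi)
    have h2 := Measure.quasiMeasurePreserving_snd (μ := (volume : Measure ℝ).restrict (Ioi 0))
      (ν := (volume : Measure ℝ).restrict (Ioo (-Real.pi) Real.pi)) |>.ae
        (hae.and (ae_restrict_mem measurableSet_Ioo))
    filter_upwards [h1, h2] with p hp1 hp2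
    rw [mul_one]
    exact hbound p.1 hp1 p.2 hp2.2 hp2.1
  rw [← integral_mob (Or.inl one_ne_zero : (1 : ℂ) ≠ 0 ∨ x ≠ 0) hIm, integral_sph_polar,
    Measure.volume_eq_prod, ← Measure.prod_restrict]
  change ∫ p, H p ∂_ = _
  rw [integral_prod_symm _ hHint]
  have h3 : ∀ᵐ θ ∂(volume.restrict (Ioo (-Real.pi) Real.pi)),
      ∫ r in Ioi (0 : ℝ), H (r, θ) = G x / (2 * Real.pi) := by
    filter_upwards [hae, ae_restrict_mem measurableSet_Ioo] with θ h1 h2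
    exact hinner θ h2 h1
  rw [integral_congr_ae h3, setIntegral_const, smul_eq_mul, Real.volume_real_Ioo_of_le (by linarith)]
  field_simp
  ring

lemma measurable_mob_pair : Measurable fun p : ℂ × ℂ => mob (conj p.2) 1 p.1 := by
  unfold mob
  have : Measurable (fun p : ℂ × ℂ => conj p.2) :=
    Complex.continuous_conj.measurable.comp measurable_snd
  simp only [Complex.conj_conj]
  fun_prop

lemma integrable_norm_mob_pair :
    Integrable (fun p : ℂ × ℂ => ‖mob (conj p.2) 1 p.1‖) (sph.prod sph) := by
  rw [integrable_prod_iff' measurable_mob_pair.norm.aestronglyMeasurable]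
  have h (y : ℂ) : conj y ≠ 0 ∨ (1 : ℂ) ≠ 0 := Or.inr one_ne_zero
  have h' (y : ℂ) : Integrable (fun x => ‖mob (conj y) 1 x‖) sph := integrable_norm_mob (h y)
  refine ⟨Eventually.of_forall fun y => by simpa only using h' y, ?_⟩
  refine (integrable_const (∫ z, ‖z‖ ∂sph)).congr (Eventually.of_forall fun y => ?_)
  simp only [norm_norm]
  have h2 := integral_mob (h y) (g := fun z => ‖z‖) measurable_norm
  simpa only using h2.symm

/-- The isoperimetric bound: Green's representation averaged over a set carrying `G`. -/
theorem integral_le_of_green {G : ℂ → ℝ} {E : ℂ → ℂ} (hG : ∀ y, HasFDerivAt G (reDer (E y)) y)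
    (hE : Measurable E) {A C : ℝ} (hA : ∀ y, |G y| ≤ A) (hC : ∀ y, (1 + ‖y‖ ^ 2) * ‖E y‖ ≤ C)
    {s : Set ℂ} (hs : ∀ x ∉ s, G x = 0) (h0 : 0 < sph.real s) (h1 : sph.real s < 1) :
    (1 - sph.real s) * ∫ y, G y ∂sph ≤
      √(sph.real s * (1 - sph.real s)) * ∫ y, (1 + ‖y‖ ^ 2) * ‖E y‖ ∂sph := by
  have hGm : Measurable G := (continuous_iff_continuousAt.2 fun y => (hG y).continuousAt).measurable
  have hconj : Measurable (fun y : ℂ => conj y) := Complex.continuous_conj.measurable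
  set K : ℂ × ℂ → ℝ := fun p => (1 + ‖p.2‖ ^ 2) * (-conj (E p.2) * mob (conj p.2) 1 p.1).re with hK
  have hKm : Measurable K := by
    refine Measurable.mul (by fun_prop) (Complex.measurable_re.comp (Measurable.mul ?_ measurable_mob_pair))
    exact (hconj.comp (hE.comp measurable_snd)).neg
  have hKb : ∀ p, ‖K p‖ ≤ C * ‖mob (conj p.2) 1 p.1‖ := by
    intro p
    rw [hK, Real.norm_eq_abs, abs_mul, abs_of_pos (by positivity)]
    calc (1 + ‖p.2‖ ^ 2) * |(-conj (E p.2) * mob (conj p.2) 1 p.1).re|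
        ≤ (1 + ‖p.2‖ ^ 2) * ‖-conj (E p.2) * mob (conj p.2) 1 p.1‖ := by
          gcongr; exact Complex.abs_re_le_norm _
      _ = ((1 + ‖p.2‖ ^ 2) * ‖E p.2‖) * ‖mob (conj p.2) 1 p.1‖ := by
          rw [norm_mul, norm_neg, Complex.norm_conj]; ring
      _ ≤ _ := by gcongr; exact hC _
  have hKint : Integrable K ((sph.restrict s).prod sph) := by
    have h := (integrable_norm_mob_pair.const_mul C).mono' hKm.aestronglyMeasurable
      (Eventually.of_forall hKb)
    have h2 := h.integrableOn (s := s ×ˢ univ)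
    rwa [IntegrableOn, ← Measure.prod_restrict, Measure.restrict_univ] at h2
  have hGint : Integrable G sph := (integrable_const A).mono' hGm.aestronglyMeasurable
    (Eventually.of_forall hA)
  have hNint : Integrable (fun y => (1 + ‖y‖ ^ 2) * ‖E y‖) sph := by
    refine (integrable_const C).mono' (by fun_prop) (Eventually.of_forall fun y => ?_)
    rw [Real.norm_of_nonneg (by positivity)]
    exact hC y
  have hrep : ∀ᵐ x ∂(sph.restrict s), ∫ y, K (x, y) ∂sph = G x - ∫ y, G y ∂sph := by
    filter_upwards [hKint.prod_right_ae] with x hx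
    rw [eq_sub_iff_add_eq', ← integral_add hGint hx, ← green_representation hG hE hA hC x]
    refine integral_congr_ae (Eventually.of_forall fun y => ?_)
    simp only [hK, Complex.mul_re, Complex.neg_re, Complex.neg_im, Complex.conj_re, Complex.conj_im]
    ring
  have hS : ∫ x in s, G x ∂sph = ∫ x, G x ∂sph := setIntegral_eq_integral_of_forall_compl_eq_zero hs
  have hdouble : ∫ x in s, ∫ y, K (x, y) ∂sph ∂sph = (1 - sph.real s) * ∫ y, G y ∂sph := by
    rw [integral_congr_ae hrep, integral_sub hGint.integrableOn (integrable_const _), hS,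
      setIntegral_const, smul_eq_mul]
    ring
  rw [← hdouble, integral_integral_swap hKint, ← integral_const_mul]
  refine integral_mono hKint.integral_prod_right (hNint.const_mul _) fun y => ?_
  simp only [hK]
  rw [integral_const_mul]
  have h2 := setIntegral_re_mul_mob_le (Or.inr one_ne_zero : conj y ≠ 0 ∨ (1 : ℂ) ≠ 0)
    (-conj (E y)) h0 h1
  rw [norm_neg, Complex.norm_conj] at h2
  calc _ ≤ (1 + ‖y‖ ^ 2) * (‖E y‖ * √(sph.real s * (1 - sph.real s))) := by gcongr
    _ = _ := by ring

/-- The real-linear map with Wirtinger coefficients `A` and `B`. -/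
noncomputable def wirt (A B : ℂ) : ℂ →L[ℝ] ℂ :=
  ContinuousLinearMap.mul ℝ ℂ A +
    (ContinuousLinearMap.mul ℝ ℂ B).comp (Complex.conjCLE : ℂ →L[ℝ] ℂ)

lemma wirt_apply (A B c : ℂ) : wirt A B c = A * c + B * conj c := rfl

/-- `g` is real differentiable at `z` with `∂g = A` and `∂̄g = B`. -/
def HasWirt (g : ℂ → ℂ) (A B z : ℂ) : Prop := HasFDerivAt g (wirt A B) z

lemma HasWirt.congr {g : ℂ → ℂ} {A B A' B' z : ℂ} (h : HasWirt g A B z) (hA : A = A')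
    (hB : B = B') : HasWirt g A' B' z := hA ▸ hB ▸ h

lemma hasWirt_of_hasDerivAt {g : ℂ → ℂ} {A z : ℂ} (h : HasDerivAt g A z) : HasWirt g A 0 z := by
  refine (h.hasFDerivAt.restrictScalars ℝ).congr_fderiv ?_
  refine ContinuousLinearMap.ext fun c => ?_
  simp [wirt_apply, mul_comm]

lemma HasWirt.conj {g : ℂ → ℂ} {A B z : ℂ} (h : HasWirt g A B z) :
    HasWirt (fun z => conj (g z)) (conj B) (conj A) z := by
  refine ((Complex.conjCLE : ℂ →L[ℝ] ℂ).hasFDerivAt.comp z h).congr_fderiv ?_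
  refine ContinuousLinearMap.ext fun c => ?_
  simp [wirt_apply]
  ring

lemma HasWirt.mul {g k : ℂ → ℂ} {A B A' B' z : ℂ} (h : HasWirt g A B z) (h' : HasWirt k A' B' z) :
    HasWirt (fun z => g z * k z) (A * k z + g z * A') (B * k z + g z * B') z := by
  refine (HasFDerivAt.mul h h').congr_fderiv ?_
  refine ContinuousLinearMap.ext fun c => ?_
  simp only [add_apply, smul_apply, wirt_apply, smul_eq_mul]
  ring

lemma HasWirt.sub {g k : ℂ → ℂ} {A B A' B' z : ℂ} (h : HasWirt g A B z) (h' : HasWirt k A' B' z) :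
    HasWirt (fun z => g z - k z) (A - A') (B - B') z := by
  refine (HasFDerivAt.sub h h').congr_fderiv ?_
  refine ContinuousLinearMap.ext fun c => ?_
  simp only [sub_apply, wirt_apply]
  ring

lemma HasWirt.comp {g k : ℂ → ℂ} {A B D z : ℂ} (h : HasWirt g A B z) (hk : HasDerivAt k D (g z)) :
    HasWirt (fun z => k (g z)) (D * A) (D * B) z := by
  refine ((hk.hasFDerivAt.restrictScalars ℝ).comp z h).congr_fderiv ?_
  refine ContinuousLinearMap.ext fun c => ?_
  simp [wirt_apply]
  ring

lemma hasWirt_ofReal {u : ℂ → ℝ} {e z : ℂ} (h : HasFDerivAt u (reDer e) z) :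
    HasWirt (fun z => (u z : ℂ)) e (conj e) z := by
  refine (Complex.ofRealCLM.hasFDerivAt.comp z h).congr_fderiv ?_
  refine ContinuousLinearMap.ext fun c => ?_
  have := Complex.add_conj (e * c)
  rw [map_mul] at this
  simp [wirt_apply, reDer_apply, this]

lemma HasWirt.hasFDerivAt_re {u : ℂ → ℝ} {e z : ℂ} (h : HasWirt (fun z => (u z : ℂ)) e (conj e) z) :
    HasFDerivAt u (reDer e) z := by
  refine (Complex.reCLM.hasFDerivAt.comp z h).congr_fderiv ?_
  refine ContinuousLinearMap.ext fun c => ?_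
  simp [wirt_apply, reDer_apply]
  ring

/-- A field decaying like `(1+|z|²)⁻¹` has vanishing total `∂̄`-flux. -/
theorem integral_dbar_eq_zero {X : ℂ → ℂ} {B : ℂ → ℝ} {C : ℝ}
    (hX : ∀ z, ∃ A, HasWirt X A (B z) z) (hB : Integrable B)
    (hC : ∀ z, ‖X z‖ ≤ C / (1 + ‖z‖ ^ 2)) : ∫ z, B z = 0 := by
  choose A hA using hX
  have hC0 : 0 ≤ C := by
    have := (norm_nonneg _).trans (hC 0)
    simpa using this
  have hcont : Continuous X := continuous_iff_continuousAt.2 fun z => (hA z).continuousAt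
  have hflux : ∀ z, Complex.I • wirt (A z) (B z) 1 - wirt (A z) (B z) Complex.I
      = ((2 * B z : ℝ) : ℂ) * Complex.I := by
    intro z
    simp [wirt_apply]
    ring
  have hvp := Complex.volume_preserving_equiv_real_prod.symm
  have hBp : Integrable (fun p : ℝ × ℝ => B (p.1 + p.2 * Complex.I)) (volume.prod volume) := by
    have h := (hvp.integrable_comp_emb
      Complex.measurableEquivRealProd.symm.measurableEmbedding).2 hB
    rw [Measure.volume_eq_prod] at h
    refine h.congr (Eventually.of_forall fun p => ?_)
    simp only [Function.comp, Complex.measurableEquivRealProd_symm_apply]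
    rw [Complex.mk_eq_add_mul_I]
  have hBi : ∫ z, B z = ∫ p : ℝ × ℝ, B (p.1 + p.2 * Complex.I) ∂(volume.prod volume) := by
    rw [← hvp.integral_comp' (g := B), Measure.volume_eq_prod]
    refine integral_congr_ae (Eventually.of_forall fun p => ?_)
    simp only [Complex.measurableEquivRealProd_symm_apply]
    rw [Complex.mk_eq_add_mul_I]
  set S : ℕ → Set (ℝ × ℝ) := fun k => Ioc (-(k : ℝ)) k ×ˢ Ioc (-(k : ℝ)) k with hS
  have hSm : ∀ k, MeasurableSet (S k) := fun k => measurableSet_Ioc.prod measurableSet_Ioc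
  have hSmono : Monotone S := by
    intro i j hij
    have hij' : (i : ℝ) ≤ j := by exact_mod_cast hij
    exact prod_mono (Ioc_subset_Ioc (by linarith) hij') (Ioc_subset_Ioc (by linarith) hij')
  have hSun : ⋃ k, S k = univ := by
    refine eq_univ_of_forall fun p => mem_iUnion.2 ?_
    obtain ⟨k, hk⟩ := exists_nat_gt (max |p.1| |p.2|)
    have h1 := abs_lt.1 ((le_max_left _ _).trans_lt hk)
    have h2 := abs_lt.1 ((le_max_right _ _).trans_lt hk)
    exact ⟨k, ⟨h1.1, h1.2.le⟩, ⟨h2.1, h2.2.le⟩⟩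
  have hlim := tendsto_setIntegral_of_monotone hSm hSmono
    (f := fun p : ℝ × ℝ => B (p.1 + p.2 * Complex.I)) (μ := volume.prod volume) hBp.integrableOn
  rw [hSun, setIntegral_univ, ← hBi] at hlim
  have hbd : ∀ k : ℕ, ‖∫ p in S k, B (p.1 + p.2 * Complex.I) ∂(volume.prod volume)‖ ≤
      4 * C * (k / (1 + (k : ℝ) ^ 2)) := by
    intro k
    have hk : (0 : ℝ) ≤ k := Nat.cast_nonneg k
    have hint : IntegrableOn (fun z => Complex.I • wirt (A z) (B z) 1 - wirt (A z) (B z) Complex.I)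
        (uIcc (-(k : ℝ)) k ×ℂ uIcc (-(k : ℝ)) k) := by
      simp_rw [hflux]
      exact (((hB.const_mul 2).ofReal (𝕜 := ℂ)).mul_const _).integrableOn
    have hg := Complex.integral_boundary_rect_of_continuousOn_of_hasFDerivAt_real X
      (fun z => wirt (A z) (B z)) ⟨-(k : ℝ), -(k : ℝ)⟩ ⟨k, k⟩ hcont.continuousOn (fun z _ => hA z) hint
    simp only [hflux] at hg
    have hR : ∫ x : ℝ in (-(k : ℝ))..k, ∫ y : ℝ in (-(k : ℝ))..k,
        ((2 * B (x + y * Complex.I) : ℝ) : ℂ) * Complex.I =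
        ((2 * ∫ p in S k, B (p.1 + p.2 * Complex.I) ∂(volume.prod volume) : ℝ) : ℂ) * Complex.I := by
      simp_rw [intervalIntegral.integral_mul_const, intervalIntegral.integral_ofReal,
        intervalIntegral.integral_const_mul]
      rw [setIntegral_prod _ hBp.integrableOn]
      simp_rw [intervalIntegral.integral_of_le (by linarith : -(k : ℝ) ≤ k)]
    rw [hR] at hg
    have hside : ∀ g : ℝ → ℂ, (∀ t, (k : ℝ) ≤ ‖g t‖) →
        ‖∫ t : ℝ in (-(k : ℝ))..k, X (g t)‖ ≤ C / (1 + (k : ℝ) ^ 2) * (2 * k) := by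
      intro g hgk
      refine (intervalIntegral.norm_integral_le_of_norm_le_const (C := C / (1 + (k : ℝ) ^ 2))
        fun t _ => (hC _).trans ?_).trans_eq ?_
      · have := hgk t
        gcongr
      · rw [abs_of_nonneg (by linarith)]; ring
    have hn := congrArg norm hg
    rw [norm_mul, Complex.norm_I, mul_one, Complex.norm_real, norm_mul, Real.norm_two] at hn
    have hre (z : ℂ) (h : (k : ℝ) ≤ |z.re|) : (k : ℝ) ≤ ‖z‖ := h.trans (Complex.abs_re_le_norm z)
    have him (z : ℂ) (h : (k : ℝ) ≤ |z.im|) : (k : ℝ) ≤ ‖z‖ := h.trans (Complex.abs_im_le_norm z)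
    have s1 := hside (fun x => x + ((-(k : ℝ) : ℝ) : ℂ) * Complex.I)
      fun t => him _ (by simp)
    have s2 := hside (fun x => x + ((k : ℝ) : ℂ) * Complex.I) fun t => him _ (by simp)
    have s3 := hside (fun y => ((k : ℝ) : ℂ) + y * Complex.I) fun t => hre _ (by simp)
    have s4 := hside (fun y => ((-(k : ℝ) : ℝ) : ℂ) + y * Complex.I) fun t => hre _ (by simp)
    have htri : ∀ a b c d : ℂ, ‖a - b + Complex.I • c - Complex.I • d‖ ≤ ‖a‖ + ‖b‖ + ‖c‖ + ‖d‖ := by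
      intro a b c d
      have h1 := norm_sub_le (a - b + Complex.I • c) (Complex.I • d)
      have h2 := norm_add_le (a - b) (Complex.I • c)
      have h3 := norm_sub_le a b
      rw [norm_smul, Complex.norm_I, one_mul] at h1 h2
      linarith
    have := (hn.symm.le.trans (htri _ _ _ _)).trans
      (add_le_add (add_le_add (add_le_add s1 s2) s3) s4)
    have e : C / (1 + (k : ℝ) ^ 2) * (2 * k) = 2 * C * (k / (1 + (k : ℝ) ^ 2)) := by ring
    rw [e] at this
    linarith
  have hz : Tendsto (fun k : ℕ => 4 * C * ((k : ℝ) / (1 + (k : ℝ) ^ 2))) atTop (𝓝 0) := by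
    rw [← mul_zero (4 * C)]
    refine Tendsto.const_mul _ ?_
    refine squeeze_zero' (g := fun k : ℕ => ((k : ℝ))⁻¹) (Eventually.of_forall fun k => by positivity)
      ?_ (tendsto_inv_atTop_zero.comp tendsto_natCast_atTop_atTop)
    filter_upwards [eventually_gt_atTop 0] with k hk
    have : (0 : ℝ) < k := by exact_mod_cast hk
    rw [div_le_iff₀ (by positivity)]
    field_simp
    linarith
  exact tendsto_nhds_unique hlim (squeeze_zero_norm hbd hz)

/-- The spherical modulus `|f(z)|²/(1+|z|²)ⁿ` of a polynomial of degree at most `n`. -/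
noncomputable def sphMod (n : ℕ) (f : Polynomial ℂ) (z : ℂ) : ℝ :=
  ‖f.eval z‖ ^ 2 / (1 + ‖z‖ ^ 2) ^ n

/-- The polynomial `z f' - n f`, of degree less than `n` when `f` has degree at most `n`. -/
noncomputable def polarPart (n : ℕ) (f : Polynomial ℂ) : Polynomial ℂ :=
  Polynomial.X * f.derivative - (n : Polynomial ℂ) * f

/-- The holomorphic derivative `∂` of `sphMod n f`. -/
noncomputable def sphDer (n : ℕ) (f : Polynomial ℂ) (z : ℂ) : ℂ :=
  conj (f.eval z) * (f.derivative.eval z + conj z * (polarPart n f).eval z) /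
    ((1 + ‖z‖ ^ 2 : ℝ) : ℂ) ^ (n + 1)

lemma sphMod_nonneg (n : ℕ) (f : Polynomial ℂ) (z : ℂ) : 0 ≤ sphMod n f z := by
  unfold sphMod; positivity

lemma eval_polarPart (n : ℕ) (f : Polynomial ℂ) (z : ℂ) :
    (polarPart n f).eval z = z * f.derivative.eval z - n * f.eval z := by
  simp [polarPart]

lemma natDegree_polarPart_le {n : ℕ} (hn : 1 ≤ n) {f : Polynomial ℂ} (hf : f.natDegree ≤ n) :
    (polarPart n f).natDegree ≤ n - 1 := by
  rw [Polynomial.natDegree_le_iff_coeff_eq_zero]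
  intro k hk
  obtain ⟨j, rfl⟩ : ∃ j, k = j + 1 := ⟨k - 1, by omega⟩
  rw [polarPart, Polynomial.coeff_sub, Polynomial.coeff_X_mul, Polynomial.coeff_derivative,
    Polynomial.coeff_natCast_mul]
  rcases Nat.lt_or_ge n (j + 1) with h | h
  · rw [Polynomial.coeff_eq_zero_of_natDegree_lt (hf.trans_lt h)]; simp
  · have : n = j + 1 := by omega
    subst this; push_cast; ring

lemma one_add_mul_conj (z : ℂ) : 1 + z * conj z = ((1 + ‖z‖ ^ 2 : ℝ) : ℂ) := by
  rw [Complex.mul_conj']; push_cast; rfl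

lemma one_add_norm_sq_ne (z : ℂ) : 1 + z * conj z ≠ 0 := by
  rw [one_add_mul_conj]; norm_cast; positivity

lemma hasWirt_inv_one_add (z : ℂ) : HasWirt (fun z => (1 + z * conj z)⁻¹)
    (-conj z / (1 + z * conj z) ^ 2) (-z / (1 + z * conj z) ^ 2) z := by
  have h0 := hasWirt_of_hasDerivAt (hasDerivAt_id z)
  have h := (h0.mul h0.conj).comp (k := fun w => (1 + w)⁻¹)
    (((hasDerivAt_id _).const_add 1).inv (one_add_norm_sq_ne z))
  refine h.congr ?_ ?_ <;> simp <;> ring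

lemma hasFDerivAt_sphMod (n : ℕ) (f : Polynomial ℂ) (z : ℂ) :
    HasFDerivAt (sphMod n f) (reDer (sphDer n f z)) z := by
  have h1 := hasWirt_of_hasDerivAt (f.hasDerivAt z)
  have h2 := (hasWirt_inv_one_add z).comp (hasDerivAt_pow n _)
  have h := (h1.mul h1.conj).mul h2
  have hp := one_add_norm_sq_ne z
  have hpow : (n : ℂ) * ((1 + z * conj z)⁻¹) ^ (n - 1) * ((1 + z * conj z)⁻¹) ^ 2 =
      n * ((1 + z * conj z)⁻¹) ^ (n + 1) := by
    rcases n with _ | n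
    · simp
    · rw [Nat.add_sub_cancel]; ring
  have hA : sphDer n f z = conj (f.eval z) * (f.derivative.eval z * (1 + z * conj z) -
      n * conj z * f.eval z) * ((1 + z * conj z)⁻¹) ^ (n + 1) := by
    rw [sphDer, eval_polarPart, ← one_add_mul_conj, inv_pow, div_eq_mul_inv]
    ring
  have hB : (1 + z * conj z)⁻¹ ^ n = (1 + z * conj z) * (1 + z * conj z)⁻¹ ^ (n + 1) := by
    rw [pow_succ]; field_simp
  refine HasWirt.hasFDerivAt_re ?_
  have hfun : (fun z => (sphMod n f z : ℂ)) = fun z => f.eval z * conj (f.eval z) *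
      ((1 + z * conj z)⁻¹) ^ n := by
    funext w
    rw [sphMod, one_add_mul_conj, Complex.mul_conj']
    push_cast
    rw [inv_pow, div_eq_mul_inv]
  rw [hfun]
  refine h.congr ?_ ?_
  · rw [hA]
    simp only [map_zero, mul_zero, add_zero, div_eq_mul_inv, ← inv_pow]
    rw [hB]
    linear_combination (-f.eval z * conj (f.eval z) * conj z) * hpow
  · rw [hA]
    simp only [map_mul, map_sub, map_add, map_pow, map_inv₀, map_one, Complex.conj_conj, map_natCast,
      zero_mul, zero_add, div_eq_mul_inv, ← inv_pow]
    rw [hB, mul_comm (conj z) z]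
    linear_combination (-f.eval z * conj (f.eval z) * z) * hpow

lemma continuous_sphMod (n : ℕ) (f : Polynomial ℂ) : Continuous (sphMod n f) :=
  continuous_iff_continuousAt.2 fun z => (hasFDerivAt_sphMod n f z).continuousAt

lemma continuous_sphDer (n : ℕ) (f : Polynomial ℂ) : Continuous (sphDer n f) := by
  unfold sphDer
  have := Complex.continuous_conj
  refine Continuous.div ?_ ?_ fun z => ?_
  · exact (this.comp f.continuous).mul (f.derivative.continuous.add
      (this.mul (polarPart n f).continuous))
  · fun_prop
  · norm_cast; positivity

lemma exists_norm_eval_le {k : ℕ} {f : Polynomial ℂ} (hf : f.natDegree ≤ k) :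
    ∃ C, 0 ≤ C ∧ ∀ z : ℂ, ‖f.eval z‖ ≤ C * √(1 + ‖z‖ ^ 2) ^ k := by
  refine ⟨∑ i ∈ Finset.range (k + 1), ‖f.coeff i‖, by positivity, fun z => ?_⟩
  rw [Polynomial.eval_eq_sum_range' (Nat.lt_succ_of_le hf), Finset.sum_mul]
  refine (norm_sum_le _ _).trans (Finset.sum_le_sum fun i hi => ?_)
  rw [norm_mul, norm_pow]
  have h1 : ‖z‖ ≤ √(1 + ‖z‖ ^ 2) := Real.le_sqrt_of_sq_le (by linarith)
  have h2 : 1 ≤ √(1 + ‖z‖ ^ 2) := Real.one_le_sqrt.2 (by nlinarith [sq_nonneg ‖z‖])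
  have h3 : i ≤ k := Nat.lt_succ_iff.1 (Finset.mem_range.1 hi)
  gcongr
  exact (pow_le_pow_left₀ (norm_nonneg z) h1 i).trans (pow_le_pow_right₀ h2 h3)

lemma exists_sphMod_le {n : ℕ} {f : Polynomial ℂ} (hf : f.natDegree ≤ n) :
    ∃ T, ∀ z, sphMod n f z ≤ T := by
  obtain ⟨C, hC0, hC⟩ := exists_norm_eval_le hf
  refine ⟨C ^ 2, fun z => ?_⟩
  have h0 : (0 : ℝ) ≤ 1 + ‖z‖ ^ 2 := by positivity
  rw [sphMod, div_le_iff₀ (by positivity)]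
  calc ‖f.eval z‖ ^ 2 ≤ (C * √(1 + ‖z‖ ^ 2) ^ n) ^ 2 := by gcongr; exact hC z
    _ = C ^ 2 * (√(1 + ‖z‖ ^ 2) ^ 2) ^ n := by ring
    _ = _ := by rw [Real.sq_sqrt h0]

lemma exists_sphDer_le {n : ℕ} (hn : 1 ≤ n) {f : Polynomial ℂ} (hf : f.natDegree ≤ n) :
    ∃ C, 0 ≤ C ∧ ∀ z, (1 + ‖z‖ ^ 2) * ‖sphDer n f z‖ ≤ C := by
  obtain ⟨C, hC0, hC⟩ := exists_norm_eval_le hf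
  obtain ⟨C₁, hC10, hC1⟩ := exists_norm_eval_le (k := n - 1) (f := f.derivative)
    ((Polynomial.natDegree_derivative_le f).trans (Nat.sub_le_sub_right hf 1))
  obtain ⟨C₂, hC20, hC2⟩ := exists_norm_eval_le (natDegree_polarPart_le hn hf)
  refine ⟨C * (C₁ + C₂), by positivity, fun z => ?_⟩
  have h0 : (0 : ℝ) < 1 + ‖z‖ ^ 2 := by positivity
  set s := √(1 + ‖z‖ ^ 2) with hs
  have hss : s ^ 2 = 1 + ‖z‖ ^ 2 := Real.sq_sqrt h0.le
  have h1 : ‖z‖ ≤ s := Real.le_sqrt_of_sq_le (by linarith)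
  have h2 : 1 ≤ s := Real.one_le_sqrt.2 (by nlinarith [sq_nonneg ‖z‖])
  have hsn : s ^ n = s * s ^ (n - 1) := by
    rw [← pow_succ']; congr 1; omega
  have h3 : ‖f.derivative.eval z + conj z * (polarPart n f).eval z‖ ≤ (C₁ + C₂) * s ^ n := by
    refine (norm_add_le _ _).trans ?_
    rw [norm_mul, Complex.norm_conj, add_mul]
    refine add_le_add ((hC1 z).trans ?_) ?_
    · gcongr
      omega
    · calc ‖z‖ * ‖(polarPart n f).eval z‖ ≤ s * (C₂ * s ^ (n - 1)) := by gcongr; exact hC2 z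
        _ = C₂ * s ^ n := by rw [hsn]; ring
  rw [sphDer, norm_div, norm_mul, Complex.norm_conj, norm_pow, Complex.norm_real,
    Real.norm_of_nonneg h0.le, pow_succ]
  calc (1 + ‖z‖ ^ 2) * (‖f.eval z‖ * ‖f.derivative.eval z + conj z * (polarPart n f).eval z‖ /
        ((1 + ‖z‖ ^ 2) ^ n * (1 + ‖z‖ ^ 2)))
      = ‖f.eval z‖ * ‖f.derivative.eval z + conj z * (polarPart n f).eval z‖ /
        (1 + ‖z‖ ^ 2) ^ n := by field_simp
    _ ≤ (C * s ^ n) * ((C₁ + C₂) * s ^ n) / (1 + ‖z‖ ^ 2) ^ n := by gcongr; exact hC z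
    _ = C * (C₁ + C₂) := by
        rw [← hss, ← pow_mul, mul_comm 2 n, pow_mul]; field_simp

/-- The integrated Bochner-type identity for `log |f|² - n log (1+|z|²)`. -/
theorem integral_sphDer_sq {n : ℕ} (hn : 1 ≤ n) {f : Polynomial ℂ} (hf : f.natDegree ≤ n)
    {φ Φ : ℝ → ℝ} {a K : ℝ} (ha : 0 < a) (hφc : Continuous φ) (hΦ : ∀ t, HasDerivAt Φ (φ t) t)
    (hφ0 : ∀ t ≤ a, φ t = 0) (hΦ0 : ∀ t ≤ a, Φ t = 0) (hφK : ∀ t, |φ t| ≤ K)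
    (hΦK : ∀ t, |Φ t| ≤ K) :
    ∫ z, φ (sphMod n f z) / sphMod n f z * ((1 + ‖z‖ ^ 2) * ‖sphDer n f z‖) ^ 2 ∂sph =
      n * ∫ z, Φ (sphMod n f z) ∂sph := by
  have hK0 : 0 ≤ K := (abs_nonneg _).trans (hφK 0)
  have hΦc : Continuous Φ := continuous_iff_continuousAt.2 fun t => (hΦ t).continuousAt
  have hvc := continuous_sphMod n f
  have hDc := continuous_sphDer n f
  obtain ⟨C, hC0, hC⟩ := exists_sphDer_le hn hf
  set g₁ : ℂ → ℝ := fun z =>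
    φ (sphMod n f z) / sphMod n f z * ((1 + ‖z‖ ^ 2) * ‖sphDer n f z‖) ^ 2 with hg1
  set g₂ : ℂ → ℝ := fun z => Φ (sphMod n f z) with hg2
  have hquot : ∀ t, |φ t / t| ≤ K / a := by
    intro t
    rcases le_or_gt t a with h | h
    · rw [hφ0 t h]; simp; positivity
    · rw [abs_div, abs_of_pos (ha.trans h)]
      gcongr
      exact hφK t
  have hm1 : Measurable g₁ := by
    refine Measurable.mul ((hφc.measurable.comp hvc.measurable).div hvc.measurable) ?_
    exact (((by fun_prop : Continuous fun z : ℂ => 1 + ‖z‖ ^ 2).mul hDc.norm).pow 2).measurable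
  have hi1 : Integrable g₁ sph := by
    refine (integrable_const (K / a * C ^ 2)).mono' hm1.aestronglyMeasurable
      (Eventually.of_forall fun z => ?_)
    rw [norm_mul, norm_pow, Real.norm_of_nonneg (by positivity : 0 ≤ (1 + ‖z‖ ^ 2) * ‖sphDer n f z‖)]
    gcongr
    · exact hquot _
    · exact hC z
  have hi2 : Integrable g₂ sph := (integrable_const K).mono'
    (hΦc.comp hvc).aestronglyMeasurable (Eventually.of_forall fun z => hΦK _)
  have hi := hi1.sub (hi2.const_mul (n : ℝ))
  set B : ℂ → ℝ := fun z => Real.pi * (sphDensity z * (g₁ z - n * g₂ z)) with hB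
  have hBint : Integrable B := (integrable_sph_iff.1 hi).const_mul Real.pi
  set L : ℂ → ℂ := fun z => f.derivative.eval z * (f.eval z)⁻¹ - n * (conj z * (1 + z * conj z)⁻¹)
    with hL
  have hDL : ∀ z, f.eval z ≠ 0 → sphDer n f z = sphMod n f z * L z := by
    intro z hz
    have hp := one_add_norm_sq_ne z
    have hv : (sphMod n f z : ℂ) = f.eval z * conj (f.eval z) / (1 + z * conj z) ^ n := by
      rw [sphMod, one_add_mul_conj, Complex.mul_conj']; push_cast; rfl
    simp only [hL]
    rw [hv, sphDer, eval_polarPart, ← one_add_mul_conj]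
    generalize hq : 1 + z * conj z = q at hp ⊢
    field_simp
    linear_combination conj (f.eval z) * f.derivative.eval z * q * q ^ n * hq
  have hne : ∀ z, a / 2 < sphMod n f z → f.eval z ≠ 0 := by
    intro z hz h0
    rw [sphMod, h0] at hz
    simp at hz
    linarith
  have hwirt : ∀ z, ∃ A, HasWirt (fun z => (Φ (sphMod n f z) : ℂ) * L z) A (B z) z := by
    intro z
    rcases lt_or_ge (sphMod n f z) a with h | h
    · refine ⟨0, ?_⟩
      have hB0 : B z = 0 := by
        rw [hB, hg1, hg2]; simp [hφ0 _ h.le, hΦ0 _ h.le]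
      rw [hB0, Complex.ofReal_zero]
      have hz0 := hasWirt_of_hasDerivAt (hasDerivAt_const z (0 : ℂ))
      refine HasFDerivAt.congr_of_eventuallyEq hz0 ?_
      filter_upwards [hvc.continuousAt.eventually_lt continuousAt_const h] with w hw
      rw [hΦ0 _ hw.le]; simp
    · have hfz := hne z (by linarith)
      have hvpos : 0 < sphMod n f z := ha.trans_le h
      have w1 : HasFDerivAt (fun z => Φ (sphMod n f z)) (reDer (φ (sphMod n f z) * sphDer n f z)) z := by
        refine ((hΦ _).comp_hasFDerivAt z (hasFDerivAt_sphMod n f z)).congr_fderiv ?_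
        refine ContinuousLinearMap.ext fun c => ?_
        simp only [smul_apply, reDer_apply, smul_eq_mul, mul_assoc]
        rw [Complex.re_ofReal_mul]; ring
      have w2 := hasWirt_ofReal w1
      have e1 := hasWirt_of_hasDerivAt (f.derivative.hasDerivAt z)
      have e2 := (hasWirt_of_hasDerivAt (f.hasDerivAt z)).comp (hasDerivAt_inv hfz)
      have e3 := (hasWirt_of_hasDerivAt (hasDerivAt_id z)).conj.mul (hasWirt_inv_one_add z)
      have e4 := (hasWirt_of_hasDerivAt (hasDerivAt_const z (n : ℂ))).mul e3
      have w3 := (e1.mul e2).sub e4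
      refine ⟨_, (w2.mul w3).congr rfl ?_⟩
      have hp := one_add_norm_sq_ne z
      have hvne : (sphMod n f z : ℂ) ≠ 0 := by exact_mod_cast hvpos.ne'
      have hLD : L z = sphDer n f z / sphMod n f z := by
        rw [hDL z hfz]; field_simp
      have hBz : (B z : ℂ) = φ (sphMod n f z) / sphMod n f z * (sphDer n f z * conj (sphDer n f z))
          - n * Φ (sphMod n f z) / (1 + z * conj z) ^ 2 := by
        simp only [hB, hg1, hg2, sphDensity]
        rw [one_add_mul_conj, Complex.mul_conj']
        have hpi := Complex.ofReal_ne_zero.2 Real.pi_ne_zero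
        have hq : ((1 + ‖z‖ ^ 2 : ℝ) : ℂ) ≠ 0 := by norm_cast; positivity
        push_cast at hq ⊢
        field_simp
      rw [hBz]
      change _ * L z + _ = _
      rw [hLD]
      simp only [map_mul, Complex.conj_ofReal, id, map_one, mul_zero, zero_mul, zero_add, add_zero]
      field_simp
      ring
  have hbound : ∀ z, ‖(Φ (sphMod n f z) : ℂ) * L z‖ ≤ (K * (C / a)) / (1 + ‖z‖ ^ 2) := by
    intro z
    rcases le_or_gt (sphMod n f z) a with h | h
    · rw [hΦ0 _ h]; simp; positivity
    · have hvpos : 0 < sphMod n f z := ha.trans h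
      have hfz := hne z (by linarith)
      have h1 : ‖L z‖ ≤ C / a / (1 + ‖z‖ ^ 2) := by
        have h2 := congrArg norm (hDL z hfz)
        rw [norm_mul, Complex.norm_real, Real.norm_of_nonneg hvpos.le] at h2
        have h3 := hC z
        rw [h2] at h3
        rw [le_div_iff₀ (by positivity), le_div_iff₀ ha]
        refine le_trans ?_ h3
        have : 0 ≤ ‖L z‖ * (1 + ‖z‖ ^ 2) := by positivity
        nlinarith
      rw [norm_mul, Complex.norm_real, Real.norm_eq_abs, mul_div_assoc]
      gcongr
      exact hΦK _
  have hz := integral_dbar_eq_zero hwirt hBint hbound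
  rw [hB, integral_const_mul, ← integral_sph] at hz
  have hz' := (mul_eq_zero.1 hz).resolve_left Real.pi_ne_zero
  rw [integral_sub hi1 (hi2.const_mul _), integral_const_mul] at hz'
  linarith

/-- The distribution function of `sphMod n f` under the normalized spherical measure. -/
noncomputable def sphCdf (n : ℕ) (f : Polynomial ℂ) (t : ℝ) : ℝ :=
  sph.real {z | sphMod n f z ≤ t}

lemma real_lt_sphMod (n : ℕ) (f : Polynomial ℂ) (t : ℝ) :
    sph.real {z | t < sphMod n f z} = 1 - sphCdf n f t := by
  have h : {z | t < sphMod n f z} = {z | sphMod n f z ≤ t}ᶜ := by ext; simp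
  rw [h, probReal_compl_eq_one_sub
    (measurableSet_le (continuous_sphMod n f).measurable measurable_const)]
  rfl

/-- Isoperimetry and the Bochner identity, combined by the Cauchy-Schwarz inequality. -/
theorem sphCdf_mul_integral_le {n : ℕ} (hn : 1 ≤ n) {f : Polynomial ℂ} (hf : f.natDegree ≤ n)
    {φ Φ : ℝ → ℝ} {a K : ℝ} (ha : 0 < a) (hφc : Continuous φ) (hΦ : ∀ t, HasDerivAt Φ (φ t) t)
    (hφ0 : ∀ t ≤ a, φ t = 0) (hΦ0 : ∀ t ≤ a, Φ t = 0) (hφK : ∀ t, |φ t| ≤ K)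
    (hΦK : ∀ t, |Φ t| ≤ K) (hφn : ∀ t, 0 ≤ φ t) (h0 : 0 < sphCdf n f a) (h1 : sphCdf n f a < 1) :
    sphCdf n f a * ∫ z, Φ (sphMod n f z) ∂sph ≤
      n * (1 - sphCdf n f a) * ∫ z, φ (sphMod n f z) * sphMod n f z ∂sph := by
  have hvc := continuous_sphMod n f
  have hDc := continuous_sphDer n f
  obtain ⟨C, hC0, hC⟩ := exists_sphDer_le hn hf
  obtain ⟨T, hT⟩ := exists_sphMod_le hf
  have hK0 : 0 ≤ K := (abs_nonneg _).trans (hφK 0)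
  have hG : ∀ z, HasFDerivAt (fun z => Φ (sphMod n f z))
      (reDer (φ (sphMod n f z) * sphDer n f z)) z := by
    intro z
    refine ((hΦ _).comp_hasFDerivAt z (hasFDerivAt_sphMod n f z)).congr_fderiv ?_
    refine ContinuousLinearMap.ext fun c => ?_
    simp only [smul_apply, reDer_apply, smul_eq_mul, mul_assoc]
    rw [Complex.re_ofReal_mul]; ring
  have hE : Continuous (fun z => (φ (sphMod n f z) : ℂ) * sphDer n f z) := by fun_prop
  have hEn : ∀ z, ‖(φ (sphMod n f z) : ℂ) * sphDer n f z‖ = φ (sphMod n f z) * ‖sphDer n f z‖ := by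
    intro z
    rw [norm_mul, Complex.norm_real, Real.norm_of_nonneg (hφn _)]
  have hEC : ∀ z, (1 + ‖z‖ ^ 2) * ‖(φ (sphMod n f z) : ℂ) * sphDer n f z‖ ≤ K * C := by
    intro z
    rw [hEn, mul_left_comm]
    exact mul_le_mul ((le_abs_self _).trans (hφK _)) (hC z) (by positivity) hK0
  have hm := real_lt_sphMod n f a
  have key := integral_le_of_green hG hE.measurable (fun z => hΦK _) hEC
    (s := {z | a < sphMod n f z}) (fun z hz => hΦ0 _ (not_lt.1 hz)) (by rw [hm]; linarith)
    (by rw [hm]; linarith)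
  rw [hm] at key
  simp only [hEn] at key
  have bochner := integral_sphDer_sq hn hf ha hφc hΦ hφ0 hΦ0 hφK hΦK
  set F := sphCdf n f a
  set S := ∫ z, Φ (sphMod n f z) ∂sph
  set R := √((1 - F) * (1 - (1 - F))) with hR
  have hRR : R ^ 2 = (1 - F) * F := by
    rw [hR, Real.sq_sqrt (by nlinarith)]; ring
  have hn0 : (0 : ℝ) < n := by exact_mod_cast hn
  set c := n * R / F with hc
  have hquot : ∀ t, |φ t / t| ≤ K / a := by
    intro t
    rcases le_or_gt t a with h | h
    · rw [hφ0 t h]; simp; positivity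
    · rw [abs_div, abs_of_pos (ha.trans h)]
      gcongr
      exact hφK t
  have i1 : Integrable (fun z => (1 + ‖z‖ ^ 2) * (φ (sphMod n f z) * ‖sphDer n f z‖)) sph := by
    refine (integrable_const (K * C)).mono' (by fun_prop) (Eventually.of_forall fun z => ?_)
    have := hEC z
    rw [hEn] at this
    rwa [Real.norm_of_nonneg (mul_nonneg (by positivity) (mul_nonneg (hφn _) (norm_nonneg _)))]
  have i2 : Integrable (fun z => φ (sphMod n f z) / sphMod n f z *
      ((1 + ‖z‖ ^ 2) * ‖sphDer n f z‖) ^ 2) sph := by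
    have hm1 : Measurable (fun z => φ (sphMod n f z) / sphMod n f z *
        ((1 + ‖z‖ ^ 2) * ‖sphDer n f z‖) ^ 2) := by
      refine Measurable.mul ((hφc.measurable.comp hvc.measurable).div hvc.measurable) ?_
      exact (((by fun_prop : Continuous fun z : ℂ => 1 + ‖z‖ ^ 2).mul hDc.norm).pow 2).measurable
    refine (integrable_const (K / a * C ^ 2)).mono' hm1.aestronglyMeasurable
      (Eventually.of_forall fun z => ?_)
    rw [norm_mul, norm_pow, Real.norm_of_nonneg (by positivity : 0 ≤ (1 + ‖z‖ ^ 2) * ‖sphDer n f z‖)]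
    gcongr
    · exact hquot _
    · exact hC z
  have i3 : Integrable (fun z => φ (sphMod n f z) * sphMod n f z) sph := by
    refine (integrable_const (K * T)).mono' (by fun_prop) (Eventually.of_forall fun z => ?_)
    rw [Real.norm_of_nonneg (mul_nonneg (hφn _) (sphMod_nonneg n f z))]
    exact mul_le_mul ((le_abs_self _).trans (hφK _)) (hT z) (sphMod_nonneg n f z) hK0
  have cs : 2 * c * ∫ z, (1 + ‖z‖ ^ 2) * (φ (sphMod n f z) * ‖sphDer n f z‖) ∂sph ≤
      n * S + c ^ 2 * ∫ z, φ (sphMod n f z) * sphMod n f z ∂sph := by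
    rw [← bochner, ← integral_const_mul, ← integral_const_mul, ← integral_add i2 (i3.const_mul _)]
    refine integral_mono (i1.const_mul _) (i2.add (i3.const_mul _)) fun z => ?_
    simp only
    rcases le_or_gt (sphMod n f z) a with h | h
    · rw [hφ0 _ h]; simp
    · have hv : 0 < sphMod n f z := ha.trans h
      have : 0 ≤ φ (sphMod n f z) / sphMod n f z *
          ((1 + ‖z‖ ^ 2) * ‖sphDer n f z‖ - c * sphMod n f z) ^ 2 :=
        mul_nonneg (div_nonneg (hφn _) hv.le) (sq_nonneg _)
      have e : φ (sphMod n f z) / sphMod n f z *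
          ((1 + ‖z‖ ^ 2) * ‖sphDer n f z‖ - c * sphMod n f z) ^ 2 =
          φ (sphMod n f z) / sphMod n f z * ((1 + ‖z‖ ^ 2) * ‖sphDer n f z‖) ^ 2
          + c ^ 2 * (φ (sphMod n f z) * sphMod n f z)
          - 2 * c * ((1 + ‖z‖ ^ 2) * (φ (sphMod n f z) * ‖sphDer n f z‖)) := by
        field_simp
        ring
      linarith
  set P := ∫ z, (1 + ‖z‖ ^ 2) * (φ (sphMod n f z) * ‖sphDer n f z‖) ∂sph
  set Q := ∫ z, φ (sphMod n f z) * sphMod n f z ∂sph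
  have cs' : 2 * (R * P) ≤ F * S + n * (1 - F) * Q := by
    have e1 : 2 * c * P = n / F * (2 * (R * P)) := by rw [hc]; ring
    have e2 : n * S + c ^ 2 * Q = n / F * (F * S + n * (1 - F) * Q) := by
      rw [hc, div_pow, mul_pow, hRR]; field_simp
    rw [e1, e2] at cs
    exact le_of_mul_le_mul_left cs (by positivity)
  have key' : F * S ≤ R * P := by
    rw [show F = 1 - (1 - F) by ring]; exact key
  linarith

lemma exists_bump {a b δ : ℝ} (hδ : 0 < δ) (hab : a + 2 * δ < b) :
    ∃ φ Φ : ℝ → ℝ, Continuous φ ∧ (∀ t, HasDerivAt Φ (φ t) t) ∧ (∀ t ≤ a, φ t = 0) ∧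
      (∀ t ≤ a, Φ t = 0) ∧ (∀ t, 0 ≤ φ t) ∧ (∀ t, φ t ≤ 1) ∧ (∀ t, b ≤ t → φ t = 0) ∧
      (∀ t, 0 ≤ Φ t) ∧ (∀ t, Φ t ≤ Φ b) ∧ (∀ t, b ≤ t → b - a - 2 * δ ≤ Φ t) := by
  set φ : ℝ → ℝ := fun t => max 0 (min 1 (min ((t - a) / δ) ((b - t) / δ))) with hφ
  have hc : Continuous φ := by fun_prop
  have hn : ∀ t, 0 ≤ φ t := fun t => le_max_left _ _
  have h1 : ∀ t, φ t ≤ 1 := fun t => max_le zero_le_one (min_le_left _ _)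
  have hzero : ∀ t, (t ≤ a ∨ b ≤ t) → φ t = 0 := by
    intro t ht
    refine max_eq_left ((min_le_right _ _).trans ?_)
    rcases ht with h | h
    · exact (min_le_left _ _).trans (div_nonpos_of_nonpos_of_nonneg (by linarith) hδ.le)
    · exact (min_le_right _ _).trans (div_nonpos_of_nonpos_of_nonneg (by linarith) hδ.le)
  have hone : ∀ t ∈ Icc (a + δ) (b - δ), φ t = 1 := by
    intro t ht
    have e1 : 1 ≤ (t - a) / δ := by rw [le_div_iff₀ hδ]; linarith [ht.1]
    have e2 : 1 ≤ (b - t) / δ := by rw [le_div_iff₀ hδ]; linarith [ht.2]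
    rw [hφ]
    simp only
    rw [min_eq_left (le_min e1 e2), max_eq_right zero_le_one]
  set Φ : ℝ → ℝ := fun t => ∫ s in a..t, φ s with hΦ
  have hd : ∀ t, HasDerivAt Φ (φ t) t := fun t => (hc.integral_hasStrictDerivAt a t).hasDerivAt
  have hmono : Monotone Φ := by
    refine monotone_of_deriv_nonneg (fun t => (hd t).differentiableAt) fun t => ?_
    rw [(hd t).deriv]; exact hn t
  have hi : ∀ x y, IntervalIntegrable φ volume x y := fun x y => hc.intervalIntegrable x y
  have hlow : ∀ t ≤ a, Φ t = 0 := by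
    intro t ht
    rw [hΦ]
    simp only
    rw [intervalIntegral.integral_symm, intervalIntegral.integral_congr (g := fun _ => (0 : ℝ))]
    · simp
    · intro s hs
      rw [uIcc_of_le ht] at hs
      exact hzero s (Or.inl hs.2)
  have hhigh : ∀ t, b ≤ t → Φ t = Φ b := by
    intro t ht
    rw [hΦ]
    simp only
    rw [← intervalIntegral.integral_add_adjacent_intervals (hi a b) (hi b t), add_eq_left,
      intervalIntegral.integral_congr (g := fun _ => (0 : ℝ))]
    · simp
    · intro s hs
      rw [uIcc_of_le ht] at hs
      exact hzero s (Or.inr hs.1)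
  have hb : b - a - 2 * δ ≤ Φ b := by
    have e1 : Φ (a + δ) + ∫ s in (a + δ)..(b - δ), φ s = Φ (b - δ) :=
      intervalIntegral.integral_add_adjacent_intervals (hi _ _) (hi _ _)
    rw [intervalIntegral.integral_congr (g := fun _ => (1 : ℝ))] at e1
    · rw [intervalIntegral.integral_const, smul_eq_mul, mul_one] at e1
      have e2 : Φ (b - δ) ≤ Φ b := hmono (by linarith)
      have e3 : 0 ≤ Φ (a + δ) := by
        rw [← hlow a le_rfl]; exact hmono (by linarith)
      linarith
    · intro s hs
      rw [uIcc_of_le (by linarith)] at hs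
      exact hone s hs
  refine ⟨φ, Φ, hc, hd, fun t ht => hzero t (Or.inl ht), hlow, hn, h1, fun t ht => hzero t (Or.inr ht),
    fun t => ?_, fun t => ?_, fun t ht => ?_⟩
  · rcases le_or_gt t a with h | h
    · exact (hlow t h).ge
    · rw [← hlow a le_rfl]; exact hmono h.le
  · rcases le_or_gt b t with h | h
    · exact (hhigh t h).le
    · exact hmono h.le
  · rw [hhigh t ht]; exact hb

lemma measurableSet_sphMod_le (n : ℕ) (f : Polynomial ℂ) (t : ℝ) :
    MeasurableSet {z | sphMod n f z ≤ t} :=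
  measurableSet_le (continuous_sphMod n f).measurable measurable_const

lemma monotone_sphCdf (n : ℕ) (f : Polynomial ℂ) : Monotone (sphCdf n f) := fun _ _ hst =>
  measureReal_mono fun _ hz => le_trans hz hst

lemma sphCdf_le_one (n : ℕ) (f : Polynomial ℂ) (t : ℝ) : sphCdf n f t ≤ 1 := measureReal_le_one

lemma sphCdf_nonneg (n : ℕ) (f : Polynomial ℂ) (t : ℝ) : 0 ≤ sphCdf n f t := measureReal_nonneg

lemma continuousWithinAt_sphCdf (n : ℕ) (f : Polynomial ℂ) (t : ℝ) :
    ContinuousWithinAt (sphCdf n f) (Ici t) t := by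
  have hm : Measurable (sphMod n f) := (continuous_sphMod n f).measurable
  have : IsProbabilityMeasure (sph.map (sphMod n f)) :=
    Measure.isProbabilityMeasure_map hm.aemeasurable
  have h : sphCdf n f = ProbabilityTheory.cdf (sph.map (sphMod n f)) := by
    ext s
    rw [ProbabilityTheory.cdf_eq_real, map_measureReal_apply hm measurableSet_Iic]
    rfl
  rw [h]
  exact (ProbabilityTheory.cdf _).right_continuous t

lemma sphCdf_mul_sub_le {n : ℕ} (hn : 1 ≤ n) {f : Polynomial ℂ} (hf : f.natDegree ≤ n) {a b : ℝ}
    (ha : 0 < a) (hab : a < b) :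
    sphCdf n f a * (1 - sphCdf n f b) * (b - a) ≤
      n * (1 - sphCdf n f a) * b * (sphCdf n f b - sphCdf n f a) := by
  have hFa := sphCdf_nonneg n f a
  have hFa' := sphCdf_le_one n f a
  have hFb' := sphCdf_le_one n f b
  have hmono := monotone_sphCdf n f hab.le
  have hb : 0 < b := ha.trans hab
  rcases hFa.eq_or_lt with h0 | h0
  · rw [← h0]
    have : (0 : ℝ) ≤ n * (1 - 0) * b * (sphCdf n f b - 0) := by
      have := sphCdf_nonneg n f b
      simp only [sub_zero]; positivity
    simpa using this
  rcases hFa'.eq_or_lt with h1 | h1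
  · have : sphCdf n f b = 1 := le_antisymm hFb' (h1 ▸ hmono)
    simp [h1, this]
  have hvm : Measurable (sphMod n f) := (continuous_sphMod n f).measurable
  have step : ∀ δ : ℝ, 0 < δ → a + 2 * δ < b →
      sphCdf n f a * (1 - sphCdf n f b) * (b - a - 2 * δ) ≤
      n * (1 - sphCdf n f a) * b * (sphCdf n f b - sphCdf n f a) := by
    intro δ hδ hδb
    obtain ⟨φ, Φ, hφc, hΦ, hφ0, hΦ0, hφn, hφ1, hφb, hΦn, hΦb, hbΦ⟩ := exists_bump hδ hδb
    have hΦc : Continuous Φ := continuous_iff_continuousAt.2 fun t => (hΦ t).continuousAt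
    have key := sphCdf_mul_integral_le hn hf (K := max 1 (Φ b)) ha hφc hΦ hφ0 hΦ0
      (fun t => by rw [abs_of_nonneg (hφn t)]; exact (hφ1 t).trans (le_max_left _ _))
      (fun t => by rw [abs_of_nonneg (hΦn t)]; exact (hΦb t).trans (le_max_right _ _)) hφn h0 h1
    have e1 : (b - a - 2 * δ) * (1 - sphCdf n f b) ≤ ∫ z, Φ (sphMod n f z) ∂sph := by
      have hms : MeasurableSet {z | b < sphMod n f z} := measurableSet_lt measurable_const hvm
      rw [← real_lt_sphMod, mul_comm, ← smul_eq_mul, ← integral_indicator_const _ hms]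
      refine integral_mono ((integrable_const _).indicator hms) ?_ fun z => ?_
      · refine Integrable.of_bound (hΦc.measurable.comp hvm).aestronglyMeasurable (Φ b)
          (Eventually.of_forall fun z => ?_)
        rw [Real.norm_of_nonneg (hΦn _)]; exact hΦb _
      · refine indicator_apply_le' (fun hz => hbΦ _ (le_of_lt hz)) fun _ => hΦn _
    have e2 : ∫ z, φ (sphMod n f z) * sphMod n f z ∂sph ≤
        b * (sphCdf n f b - sphCdf n f a) := by
      have hms : MeasurableSet ({z | sphMod n f z ≤ b} \ {z | sphMod n f z ≤ a}) :=
        (measurableSet_sphMod_le n f b).diff (measurableSet_sphMod_le n f a)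
      have hd : sphCdf n f b - sphCdf n f a =
          sph.real ({z | sphMod n f z ≤ b} \ {z | sphMod n f z ≤ a}) := by
        have hsub : {z | sphMod n f z ≤ a} ⊆ {z | sphMod n f z ≤ b} :=
          fun z hz => le_trans hz hab.le
        rw [measureReal_sdiff hsub (measurableSet_sphMod_le n f a)]
        rfl
      have hle : ∀ z, φ (sphMod n f z) * sphMod n f z ≤
          ({z | sphMod n f z ≤ b} \ {z | sphMod n f z ≤ a}).indicator (fun _ => b) z := by
        intro z
        refine le_indicator_apply (fun hz => ?_) fun hz => ?_
        · exact (mul_le_mul (hφ1 _) hz.1 (sphMod_nonneg n f z) zero_le_one).trans_eq (one_mul b)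
        · rcases le_or_gt (sphMod n f z) a with h | h
          · rw [hφ0 _ h, zero_mul]
          · rw [hφb _ (le_of_not_ge fun h' => hz ⟨h', not_le.2 h⟩), zero_mul]
      rw [hd, mul_comm, ← smul_eq_mul, ← integral_indicator_const _ hms]
      refine integral_mono ?_ ((integrable_const _).indicator hms) hle
      refine Integrable.of_bound ((hφc.measurable.comp hvm).mul hvm).aestronglyMeasurable b
          (Eventually.of_forall fun z => ?_)
      have h0 : 0 ≤ φ (sphMod n f z) * sphMod n f z := mul_nonneg (hφn _) (sphMod_nonneg n f z)
      rw [Real.norm_of_nonneg h0]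
      exact (hle z).trans (indicator_apply_le' (fun _ => le_rfl) fun _ => hb.le)
    calc sphCdf n f a * (1 - sphCdf n f b) * (b - a - 2 * δ)
        = sphCdf n f a * ((b - a - 2 * δ) * (1 - sphCdf n f b)) := by ring
      _ ≤ sphCdf n f a * ∫ z, Φ (sphMod n f z) ∂sph := mul_le_mul_of_nonneg_left e1 hFa
      _ ≤ n * (1 - sphCdf n f a) * ∫ z, φ (sphMod n f z) * sphMod n f z ∂sph := key
      _ ≤ n * (1 - sphCdf n f a) * (b * (sphCdf n f b - sphCdf n f a)) :=
        mul_le_mul_of_nonneg_left e2 (mul_nonneg (Nat.cast_nonneg n) (by linarith))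
      _ = _ := by ring
  have ht : Tendsto (fun δ : ℝ => sphCdf n f a * (1 - sphCdf n f b) * (b - a - 2 * δ)) (𝓝[>] 0)
      (𝓝 (sphCdf n f a * (1 - sphCdf n f b) * (b - a - 2 * 0))) :=
    (Continuous.tendsto (by fun_prop) 0).mono_left nhdsWithin_le_nhds
  rw [mul_zero, sub_zero] at ht
  refine le_of_tendsto ht ?_
  have hlt : ∀ᶠ δ : ℝ in 𝓝[>] 0, δ < (b - a) / 2 :=
    nhdsWithin_le_nhds (Iio_mem_nhds (by linarith))
  filter_upwards [hlt, self_mem_nhdsWithin] with δ h1 h2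
  exact step δ h2 (by linarith)

/-- Continuous-induction form of the differential inequality `n t F' ≥ F`. -/
lemma mul_rpow_le_of_sub_le {F : ℝ → ℝ} {N : ℝ} (hN : 0 < N) (hmono : Monotone F)
    (hrc : ∀ t, ContinuousWithinAt F (Ici t) t) (h0 : ∀ t, 0 ≤ F t)
    (hD : ∀ a b, 0 < a → a < b → F a * (1 - F b) * (b - a) ≤ N * (1 - F a) * b * (F b - F a))
    {a b : ℝ} (ha : 0 < a) (hab : a ≤ b) (hb : F b < 1) :
    F a * (b / a) ^ (1 / N) ≤ F b := by
  rcases (h0 a).eq_or_lt with hFa | hFa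
  · rw [← hFa, zero_mul]; exact h0 b
  have main : ∀ c : ℝ, 0 < c → c < 1 / N → F a * (b / a) ^ c ≤ F b := by
    intro c hc hcN
    set S : Set ℝ := {t | a ≤ t ∧ t ≤ b ∧ F a * (t / a) ^ c ≤ F t} with hS
    have haS : a ∈ S := ⟨le_rfl, hab, by rw [div_self ha.ne', Real.one_rpow, mul_one]⟩
    have hbdd : BddAbove S := ⟨b, fun t ht => ht.2.1⟩
    set s := sSup S with hs
    have has : a ≤ s := le_csSup hbdd haS
    have hsb : s ≤ b := csSup_le ⟨a, haS⟩ fun t ht => ht.2.1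
    have hs0 : 0 < s := ha.trans_le has
    have hsS : F a * (s / a) ^ c ≤ F s := by
      have hcl : IsClosed {t | F a * (t / a) ^ c ≤ F s} :=
        isClosed_le (continuous_const.mul
          ((continuous_id.div_const a).rpow_const fun _ => Or.inr hc.le)) continuous_const
      refine closure_minimal (fun t ht => ?_) hcl (csSup_mem_closure ⟨a, haS⟩ hbdd)
      exact ht.2.2.trans (hmono (le_csSup hbdd ht))
    rcases hsb.eq_or_lt with h | hsb'
    · rwa [h] at hsS
    exfalso
    have hFs1 : F s < 1 := (hmono hsb).trans_lt hb
    have hFs0 : 0 < F s := hFa.trans_le (hmono has)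
    have hg : HasDerivAt (fun t : ℝ => (t / s) ^ c) (c / s) s := by
      have h1 : HasDerivAt (fun t : ℝ => t / s) (1 / s) s := (hasDerivAt_id s).div_const s
      refine (h1.rpow_const (p := c) (Or.inl (by rw [div_self hs0.ne']; exact one_ne_zero))).congr_deriv ?_
      rw [div_self hs0.ne', Real.one_rpow]; ring
    have hsl := (hasDerivAt_iff_tendsto_slope.1 hg).mono_left
      (nhdsWithin_mono s (fun t (ht : t ∈ Ioi s) => (ne_of_gt ht : t ≠ s)))
    have hk : Tendsto (fun t => (1 - F t) / (1 - F s) / (N * t)) (𝓝[>] s) (𝓝 (1 / (N * s))) := by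
      have h1 : Tendsto F (𝓝[>] s) (𝓝 (F s)) := (hrc s).mono_left (nhdsWithin_mono s Ioi_subset_Ici_self)
      have h2 : Tendsto (fun t : ℝ => N * t) (𝓝[>] s) (𝓝 (N * s)) :=
        (Continuous.tendsto (by fun_prop) s).mono_left nhdsWithin_le_nhds
      have h3 := ((h1.const_sub 1).div_const (1 - F s)).div h2 (by positivity)
      rwa [div_self (by linarith : (1 - F s) ≠ 0)] at h3
    have hlt : c / s < 1 / (N * s) := by
      rw [← div_div]; gcongr
    have hev := hsl.eventually_lt hk hlt
    have hev2 : ∀ᶠ t in 𝓝[>] s, t < b := nhdsWithin_le_nhds (Iio_mem_nhds hsb')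
    obtain ⟨t, ht, htb, hst⟩ := (hev.and (hev2.and self_mem_nhdsWithin)).exists
    have hst : s < t := hst
    have ht0 : 0 < t := hs0.trans hst
    have htS : t ∈ S := by
      refine ⟨has.trans hst.le, htb.le, ?_⟩
      have hle : F s * (t / s) ^ c ≤ F t := by
        rw [slope_def_field, div_self hs0.ne', Real.one_rpow, div_lt_iff₀ (by linarith)] at ht
        have hD' := hD s t hs0 hst
        have h4 : F s * ((1 - F t) / (1 - F s) / (N * t) * (t - s)) ≤ F t - F s := by
          have : 0 < (1 - F s) * (N * t) := mul_pos (by linarith) (by positivity)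
          rw [div_div, div_mul_eq_mul_div, ← mul_div_assoc, div_le_iff₀ this]
          linarith
        have h5 := mul_le_mul_of_nonneg_left ht.le hFs0.le
        linarith
      have h6 : (t / a) ^ c = (s / a) ^ c * (t / s) ^ c := by
        rw [← Real.mul_rpow (by positivity) (by positivity)]
        congr 1; field_simp
      rw [h6, ← mul_assoc]
      exact (mul_le_mul_of_nonneg_right hsS (by positivity)).trans hle
    exact absurd (le_csSup hbdd htS) (not_le.2 hst)
  have hba : 0 < b / a := div_pos (ha.trans_le hab) ha
  have ht : Tendsto (fun c : ℝ => F a * (b / a) ^ c) (𝓝[<] (1 / N)) (𝓝 (F a * (b / a) ^ (1 / N))) :=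
    (tendsto_const_nhds.mul ((Real.continuous_const_rpow hba.ne').tendsto _)).mono_left
      nhdsWithin_le_nhds
  refine le_of_tendsto ht ?_
  have hp : ∀ᶠ c : ℝ in 𝓝[<] (1 / N), 0 < c :=
    nhdsWithin_le_nhds (Ioi_mem_nhds (by positivity))
  filter_upwards [hp, self_mem_nhdsWithin] with c h1 h2
  exact main c h1 h2

theorem sphCdf_mul_rpow_le {n : ℕ} (hn : 1 ≤ n) {f : Polynomial ℂ} (hf : f.natDegree ≤ n)
    {a b : ℝ} (ha : 0 < a) (hab : a ≤ b) (hb : sphCdf n f b < 1) :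
    sphCdf n f a * (b / a) ^ (1 / (n : ℝ)) ≤ sphCdf n f b :=
  mul_rpow_le_of_sub_le (by exact_mod_cast hn) (monotone_sphCdf n f)
    (continuousWithinAt_sphCdf n f) (sphCdf_nonneg n f)
    (fun _ _ ha hab => sphCdf_mul_sub_le hn hf ha hab) ha hab hb

/-- The distribution function `min 1 (t / c) ^ m` of the extremal functions, for `t ≥ 0`. -/
noncomputable def extCdf (c m t : ℝ) : ℝ := min 1 ((t / c) ^ m)

lemma measurable_extCdf (c m : ℝ) : Measurable (extCdf c m) :=
  measurable_const.min ((measurable_id.div_const c).pow_const m)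

lemma extCdf_of_ge {c m t : ℝ} (hc : 0 < c) (hm : 0 < m) (ht : c ≤ t) : extCdf c m t = 1 :=
  min_eq_left (Real.one_le_rpow ((one_le_div hc).2 ht) hm.le)

lemma extCdf_of_le {c m t : ℝ} (hc : 0 < c) (hm : 0 < m) (ht0 : 0 ≤ t) (ht : t ≤ c) :
    extCdf c m t = (t / c) ^ m :=
  min_eq_right (Real.rpow_le_one (by positivity) ((div_le_one hc).2 ht) hm.le)

lemma extCdf_nonneg {c m t : ℝ} (hc : 0 < c) (ht0 : 0 ≤ t) : 0 ≤ extCdf c m t :=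
  le_min zero_le_one (by positivity)

lemma integrableOn_rpow_mul {α R : ℝ} (hα : 0 < α) (hR : 0 ≤ R) {G : ℝ → ℝ} (hG : Measurable G)
    {C : ℝ} (hGC : ∀ t, 0 < t → |G t| ≤ C) :
    IntegrableOn (fun t => t ^ (α - 1) * G t) (Ioc 0 R) := by
  have h : IntegrableOn (fun t : ℝ => t ^ (α - 1)) (Ioc 0 R) :=
    (intervalIntegrable_iff_integrableOn_Ioc_of_le hR).1
      (intervalIntegral.intervalIntegrable_rpow' (by linarith))
  refine h.mul_bdd (c := C) hG.aestronglyMeasurable ?_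
  filter_upwards [ae_restrict_mem measurableSet_Ioc] with t ht
  exact hGC t ht.1

lemma setIntegral_rpow {α R : ℝ} (hα : 0 < α) (hR : 0 ≤ R) :
    ∫ t in Ioc 0 R, t ^ (α - 1) = R ^ α / α := by
  rw [← intervalIntegral.integral_of_le hR, integral_rpow (Or.inl (by linarith))]
  rw [sub_add_cancel, Real.zero_rpow hα.ne', sub_zero]

lemma setIntegral_one_sub_extCdf {α c N R : ℝ} (hα : 0 < α) (hc : 0 < c) (hN : 0 < N)
    (hR : c ≤ R) :
    α * ∫ t in Ioc 0 R, t ^ (α - 1) * (1 - extCdf c (1 / N) t) = c ^ α / (N * α + 1) := by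
  have hm : 0 < 1 / N := by positivity
  have hsub : ∫ t in Ioc 0 R, t ^ (α - 1) * (1 - extCdf c (1 / N) t) =
      ∫ t in Ioc 0 c, t ^ (α - 1) * (1 - extCdf c (1 / N) t) := by
    refine setIntegral_eq_of_subset_of_forall_sdiff_eq_zero measurableSet_Ioc
      (Ioc_subset_Ioc_right hR) fun t ht => ?_
    have : c ≤ t := by
      by_contra h
      exact ht.2 ⟨ht.1.1, (not_le.1 h).le⟩
    rw [extCdf_of_ge hc hm this, sub_self, mul_zero]
  have hint : ∀ β : ℝ, 0 < β → IntegrableOn (fun t : ℝ => t ^ (β - 1)) (Ioc 0 c) := fun β hβ =>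
    (intervalIntegrable_iff_integrableOn_Ioc_of_le hc.le).1
      (intervalIntegral.intervalIntegrable_rpow' (by linarith))
  have hcongr : ∫ t in Ioc 0 c, t ^ (α - 1) * (1 - extCdf c (1 / N) t) =
      ∫ t in Ioc 0 c, (t ^ (α - 1) - (c ^ (1 / N))⁻¹ * t ^ (α + 1 / N - 1)) := by
    refine setIntegral_congr_fun measurableSet_Ioc fun t ht => ?_
    rw [extCdf_of_le hc hm ht.1.le ht.2, Real.div_rpow ht.1.le hc.le,
      show α + 1 / N - 1 = (α - 1) + 1 / N by ring, Real.rpow_add ht.1]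
    ring
  rw [hsub, hcongr, integral_sub (hint α hα) ((hint (α + 1 / N) (by positivity)).const_mul _),
    integral_const_mul, setIntegral_rpow hα hc.le, setIntegral_rpow (by positivity) hc.le,
    Real.rpow_add hc]
  have : c ^ (1 / N) ≠ 0 := (Real.rpow_pos_of_pos hc _).ne'
  field_simp
  ring

section LayerCake

variable {Ω : Type*} [MeasurableSpace Ω] {μ : Measure Ω} [IsProbabilityMeasure μ] {v : Ω → ℝ}

lemma integral_rpow_eq_setIntegral (hv : Measurable v) (hv0 : ∀ ω, 0 ≤ v ω) {R : ℝ}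
    (hR : ∀ ω, v ω ≤ R) {α : ℝ} (hα : 0 < α) :
    ∫ ω, v ω ^ α ∂μ = α * ∫ t in Ioc 0 R, t ^ (α - 1) * (1 - μ.real {ω | v ω ≤ t}) := by
  have hF : ∀ t, μ.real {ω | t < v ω} = 1 - μ.real {ω | v ω ≤ t} := by
    intro t
    rw [← probReal_compl_eq_one_sub (measurableSet_le hv measurable_const)]
    congr 1; ext; simp
  have hmono : Monotone fun t => μ.real {ω | v ω ≤ t} := fun s t hst =>
    measureReal_mono fun ω hω => le_trans hω hst
  have h1 : ∫ t in Ioc 0 R, t ^ (α - 1) * (1 - μ.real {ω | v ω ≤ t}) =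
      ∫ t in Ioi 0, t ^ (α - 1) * (1 - μ.real {ω | v ω ≤ t}) := by
    symm
    refine setIntegral_eq_of_subset_of_forall_sdiff_eq_zero measurableSet_Ioi
      Ioc_subset_Ioi_self fun t ht => ?_
    have htR : R ≤ t := by
      by_contra h
      exact ht.2 ⟨ht.1, (not_le.1 h).le⟩
    have : {ω | v ω ≤ t} = univ := eq_univ_of_forall fun ω => (hR ω).trans htR
    simp [this]
  rw [h1, integral_eq_lintegral_of_nonneg_ae (Eventually.of_forall fun ω => by
      simpa using Real.rpow_nonneg (hv0 ω) α) (hv.pow_const α).aestronglyMeasurable,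
    lintegral_rpow_eq_lintegral_meas_lt_mul μ (Eventually.of_forall hv0) hv.aemeasurable hα,
    ENNReal.toReal_mul, ENNReal.toReal_ofReal hα.le, integral_eq_lintegral_of_nonneg_ae]
  · congr 2
    refine setLIntegral_congr_fun measurableSet_Ioi fun t ht => ?_
    rw [← hF, ENNReal.ofReal_mul (Real.rpow_nonneg (le_of_lt ht) _), ofReal_measureReal, mul_comm]
  · filter_upwards [ae_restrict_mem measurableSet_Ioi] with t ht
    rw [← hF]
    exact mul_nonneg (Real.rpow_nonneg (le_of_lt ht) _) measureReal_nonneg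
  · exact ((measurable_id.pow_const _).mul
      (measurable_const.sub hmono.measurable)).aestronglyMeasurable

/-- Comparison of moments for a random variable whose distribution function `F` makes
`t ↦ F t / t ^ (1 / N)` nondecreasing as long as `F < 1`. -/
theorem moment_compare (hv : Measurable v) (hv0 : ∀ ω, 0 ≤ v ω) {T : ℝ} (hT : ∀ ω, v ω ≤ T)
    {N : ℝ} (hN : 0 < N)
    (hF : ∀ a b, 0 < a → a ≤ b → μ.real {ω | v ω ≤ b} < 1 →
      μ.real {ω | v ω ≤ a} * (b / a) ^ (1 / N) ≤ μ.real {ω | v ω ≤ b})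
    {α β c : ℝ} (hα : 0 < α) (hαβ : α < β) (hc : 0 < c)
    (hJ : (N * α + 1) * ∫ ω, v ω ^ α ∂μ = c ^ α) :
    (N * β + 1) * ∫ ω, v ω ^ β ∂μ ≤ c ^ β ∧
    ((N * β + 1) * ∫ ω, v ω ^ β ∂μ = c ^ β → (N + 1) * ∫ ω, v ω ∂μ ≤ T) := by
  set F : ℝ → ℝ := fun t => μ.real {ω | v ω ≤ t} with hFdef
  set m := 1 / N with hm
  have hm0 : 0 < m := by positivity
  have hβ : 0 < β := hα.trans hαβ
  have hFmono : Monotone F := fun s t hst => measureReal_mono fun ω hω => le_trans hω hst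
  have hF1 : ∀ t, F t ≤ 1 := fun t => measureReal_le_one
  have hF0 : ∀ t, 0 ≤ F t := fun t => measureReal_nonneg
  set R := max c T with hR
  have hcR : c ≤ R := le_max_left _ _
  have hR0 : 0 < R := hc.trans_le hcR
  have hTR : ∀ ω, v ω ≤ R := fun ω => (hT ω).trans (le_max_right _ _)
  have hFT : ∀ t, T ≤ t → F t = 1 := by
    intro t ht
    have : {ω | v ω ≤ t} = univ := eq_univ_of_forall fun ω => (hT ω).trans ht
    simp [hFdef, this]
  have hFc : ∀ t, R ≤ t → F t = 1 ∧ extCdf c m t = 1 := fun t ht =>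
    ⟨hFT t ((le_max_right _ _).trans ht), extCdf_of_ge hc hm0 (hcR.trans ht)⟩
  have hG0 : ∀ t, 0 < t → |1 - F t| ≤ 1 := fun t _ => by
    rw [abs_le]; constructor <;> linarith [hF0 t, hF1 t]
  have hE0 : ∀ t, 0 < t → |1 - extCdf c m t| ≤ 1 := fun t ht => by
    have h1 := extCdf_nonneg (m := m) hc ht.le
    have h2 : extCdf c m t ≤ 1 := min_le_left _ _
    rw [abs_le]; constructor <;> linarith
  have hD0 : ∀ t, 0 < t → |F t - extCdf c m t| ≤ 1 := fun t ht => by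
    have h1 := extCdf_nonneg (m := m) hc ht.le
    have h2 : extCdf c m t ≤ 1 := min_le_left _ _
    rw [abs_le]; constructor <;> linarith [hF0 t, hF1 t]
  have hDm : Measurable fun t => F t - extCdf c m t :=
    hFmono.measurable.sub (measurable_extCdf c m)
  have hdiff : ∀ γ, 0 < γ → (N * γ + 1) * ∫ ω, v ω ^ γ ∂μ =
      c ^ γ - (N * γ + 1) * γ * ∫ t in Ioc 0 R, t ^ (γ - 1) * (F t - extCdf c m t) := by
    intro γ hγ
    have h1 := setIntegral_one_sub_extCdf hγ hc hN hcR
    have h2 : ∫ t in Ioc 0 R, t ^ (γ - 1) * (F t - extCdf c m t) =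
        (∫ t in Ioc 0 R, t ^ (γ - 1) * (1 - extCdf c m t)) -
          ∫ t in Ioc 0 R, t ^ (γ - 1) * (1 - F t) := by
      have hi1 := integrableOn_rpow_mul (G := fun t => 1 - extCdf c m t) hγ hR0.le
        (measurable_const.sub (measurable_extCdf c m)) hE0
      have hi2 := integrableOn_rpow_mul (G := fun t => 1 - F t) hγ hR0.le
        (measurable_const.sub hFmono.measurable) hG0
      rw [← integral_sub hi1 hi2]
      congr 1; ext t; ring
    have h3 : (N * γ + 1) ≠ 0 := by positivity
    rw [h2, integral_rpow_eq_setIntegral hv hv0 hTR hγ]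
    rw [eq_div_iff h3] at h1
    linear_combination h1
  obtain ⟨t0, ht0, hlo, hhi⟩ : ∃ t0 : ℝ, 0 ≤ t0 ∧
      (∀ t, 0 < t → t < t0 → F t ≤ extCdf c m t) ∧ (∀ t, t0 < t → extCdf c m t ≤ F t) := by
    set S : Set ℝ := {t | 0 < t ∧ (t = R ∨ extCdf c m t < F t)} with hS
    have hRS : R ∈ S := ⟨hR0, Or.inl rfl⟩
    have hb : BddBelow S := ⟨0, fun t ht => ht.1.le⟩
    refine ⟨sInf S, le_csInf ⟨R, hRS⟩ fun t ht => ht.1.le, fun t h0 ht => ?_, fun t ht => ?_⟩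
    · by_contra h
      exact absurd (csInf_le hb (show t ∈ S from ⟨h0, Or.inr (not_le.1 h)⟩)) (not_le.2 ht)
    · obtain ⟨s, ⟨hs0, hs⟩, hst⟩ := exists_lt_of_csInf_lt ⟨R, hRS⟩ ht
      rcases hs with rfl | hs
      · rw [(hFc t hst.le).1]; exact min_le_left _ _
      rcases (hF1 t).eq_or_lt with h1 | h1
      · rw [h1]; exact min_le_left _ _
      have hsc : s < c := by
        by_contra h
        rw [extCdf_of_ge hc hm0 (not_lt.1 h)] at hs
        exact absurd (hF1 s) (not_le.2 hs)
      rw [extCdf_of_le hc hm0 hs0.le hsc.le] at hs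
      calc extCdf c m t ≤ (t / c) ^ m := min_le_right _ _
        _ = (s / c) ^ m * (t / s) ^ m := by
          rw [← Real.mul_rpow (by positivity) (div_nonneg (hs0.trans hst).le hs0.le)]
          congr 1; field_simp
        _ ≤ F s * (t / s) ^ m :=
          mul_le_mul_of_nonneg_right hs.le
            (Real.rpow_nonneg (div_nonneg (hs0.trans hst).le hs0.le) _)
        _ ≤ F t := hF s t hs0 hst.le h1
  have hα' := hdiff α hα
  have hzero : ∫ t in Ioc 0 R, t ^ (α - 1) * (F t - extCdf c m t) = 0 := by
    have h3 : (N * α + 1) * α ≠ 0 := by positivity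
    have : (N * α + 1) * α * ∫ t in Ioc 0 R, t ^ (α - 1) * (F t - extCdf c m t) = 0 := by linarith
    exact (mul_eq_zero.1 this).resolve_left h3
  have hintα := integrableOn_rpow_mul hα hR0.le hDm hD0
  have hintβ := integrableOn_rpow_mul hβ hR0.le hDm hD0
  set w : ℝ → ℝ := fun t => t ^ (α - 1) * (t ^ (β - α) - t0 ^ (β - α)) with hw
  have hwint : (fun t => w t * (F t - extCdf c m t)) =ᵐ[volume.restrict (Ioc 0 R)]
      fun t => t ^ (β - 1) * (F t - extCdf c m t) -
        t0 ^ (β - α) * (t ^ (α - 1) * (F t - extCdf c m t)) := by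
    filter_upwards [ae_restrict_mem measurableSet_Ioc] with t ht
    simp only [hw]
    rw [show β - 1 = (α - 1) + (β - α) by ring, Real.rpow_add ht.1]
    ring
  have hwI : IntegrableOn (fun t => w t * (F t - extCdf c m t)) (Ioc 0 R) :=
    (hintβ.sub (hintα.const_mul _)).congr hwint.symm
  have hweq : ∫ t in Ioc 0 R, w t * (F t - extCdf c m t) =
      ∫ t in Ioc 0 R, t ^ (β - 1) * (F t - extCdf c m t) := by
    rw [integral_congr_ae hwint, integral_sub hintβ (hintα.const_mul _), integral_const_mul,
      hzero, mul_zero, sub_zero]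
  have hw0 : ∀ t, 0 < t → 0 ≤ w t * (F t - extCdf c m t) := by
    intro t ht
    have hp : 0 < t ^ (α - 1) := Real.rpow_pos_of_pos ht _
    rcases lt_trichotomy t t0 with h | h | h
    · refine mul_nonneg_of_nonpos_of_nonpos (mul_nonpos_of_nonneg_of_nonpos hp.le ?_) ?_
      · exact sub_nonpos.2 (Real.rpow_le_rpow ht.le h.le (by linarith))
      · exact sub_nonpos.2 (hlo t ht h)
    · simp [hw, h]
    · refine mul_nonneg (mul_nonneg hp.le ?_) ?_
      · exact sub_nonneg.2 (Real.rpow_le_rpow ht0 h.le (by linarith))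
      · exact sub_nonneg.2 (hhi t h)
  have hw0' : 0 ≤ᵐ[volume.restrict (Ioc 0 R)] fun t => w t * (F t - extCdf c m t) := by
    filter_upwards [ae_restrict_mem measurableSet_Ioc] with t ht using hw0 t ht.1
  have hpos : 0 ≤ ∫ t in Ioc 0 R, t ^ (β - 1) * (F t - extCdf c m t) := by
    rw [← hweq]; exact integral_nonneg_of_ae hw0'
  have hβ' := hdiff β hβ
  have h3 : 0 < (N * β + 1) * β := by positivity
  refine ⟨by nlinarith [mul_nonneg h3.le hpos], fun heq => ?_⟩
  have hz : ∫ t in Ioc 0 R, w t * (F t - extCdf c m t) = 0 := by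
    have : (N * β + 1) * β * ∫ t in Ioc 0 R, t ^ (β - 1) * (F t - extCdf c m t) = 0 := by linarith
    rw [hweq]
    exact (mul_eq_zero.1 this).resolve_left h3.ne'
  rw [integral_eq_zero_iff_of_nonneg_ae hw0' hwI] at hz
  have hFe : ∀ᵐ t ∂volume.restrict (Ioc 0 R), F t = extCdf c m t := by
    have hne : ∀ᵐ t ∂volume.restrict (Ioc 0 R), t ≠ t0 :=
      ae_restrict_of_ae (Measure.ae_ne volume t0)
    filter_upwards [hz, hne, ae_restrict_mem measurableSet_Ioc] with t h1 h2 h3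
    rcases mul_eq_zero.1 h1 with h | h
    · rcases mul_eq_zero.1 h with h | h
      · exact absurd h (Real.rpow_pos_of_pos h3.1 _).ne'
      · exact absurd ((Real.rpow_left_inj h3.1.le ht0 (by linarith)).1 (sub_eq_zero.1 h)) h2
    · exact sub_eq_zero.1 h
  have hone := hdiff 1 one_pos
  have hz1 : ∫ t in Ioc 0 R, t ^ ((1 : ℝ) - 1) * (F t - extCdf c m t) = 0 := by
    rw [integral_eq_zero_of_ae]
    filter_upwards [hFe] with t ht
    simp [ht]
  rw [hz1] at hone
  simp only [Real.rpow_one, mul_one, mul_zero, sub_zero] at hone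
  rw [hone]
  by_contra hcT
  have hcT : T < c := not_le.1 hcT
  have hsub : ∀ᵐ t ∂volume.restrict (Ioo (max 0 T) c), F t = extCdf c m t :=
    ae_restrict_of_ae_restrict_of_subset (fun t (ht : t ∈ Ioo (max 0 T) c) =>
      (⟨(le_max_left _ _).trans_lt ht.1, ht.2.le.trans hcR⟩ : t ∈ Ioc 0 R)) hFe
  have hne : (ae (volume.restrict (Ioo (max 0 T) c))).NeBot := by
    rw [ae_neBot, Ne, Measure.restrict_eq_zero, Real.volume_Ioo]
    simp [hc, hcT]
  obtain ⟨t, ht1, ht2⟩ := (hsub.and (ae_restrict_mem measurableSet_Ioo)).exists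
  have htp : 0 < t := (le_max_left _ _).trans_lt ht2.1
  rw [hFT t ((le_max_right _ _).trans ht2.1.le), extCdf_of_le hc hm0 htp.le ht2.2.le] at ht1
  exact absurd ht1 (Real.rpow_lt_one (by positivity) ((div_lt_one hc).2 ht2.2) hm0).ne'

end LayerCake

instance : sph.IsOpenPosMeasure := by
  have h : volume ≪ sph := withDensity_absolutelyContinuous'
    (measurable_ofReal_sphDensity.aemeasurable)
    (Eventually.of_forall fun z => (ENNReal.ofReal_pos.2 (sphDensity_pos z)).ne')
  exact h.isOpenPosMeasure

/-- The homogenization of a polynomial of degree at most `n`. -/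
noncomputable def homog (n : ℕ) (f : Polynomial ℂ) (x y : ℂ) : ℂ :=
  ∑ k ∈ Finset.range (n + 1), f.coeff k * y ^ k * x ^ (n - k)

lemma continuous_homog (n : ℕ) (f : Polynomial ℂ) :
    Continuous fun p : ℂ × ℂ => homog n f p.1 p.2 := by
  unfold homog; fun_prop

lemma homog_one {n : ℕ} {f : Polynomial ℂ} (hf : f.natDegree ≤ n) (z : ℂ) :
    homog n f 1 z = f.eval z := by
  rw [Polynomial.eval_eq_sum_range' (Nat.lt_succ_of_le hf), homog]
  simp

lemma homog_mul (n : ℕ) (f : Polynomial ℂ) (s x y : ℂ) :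
    homog n f (s * x) (s * y) = s ^ n * homog n f x y := by
  rw [homog, homog, Finset.mul_sum]
  refine Finset.sum_congr rfl fun k hk => ?_
  have hk : k ≤ n := Nat.lt_succ_iff.1 (Finset.mem_range.1 hk)
  rw [mul_pow, mul_pow, ← Nat.add_sub_of_le hk, pow_add]
  simp only [Nat.add_sub_cancel_left]
  ring

/-- The action of the Möbius transformation `mob a b` on polynomials of degree at most `n`. -/
noncomputable def mobPoly (n : ℕ) (f : Polynomial ℂ) (a b : ℂ) : Polynomial ℂ :=
  ∑ k ∈ Finset.range (n + 1), Polynomial.C (f.coeff k) *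
    (Polynomial.C a * Polynomial.X + Polynomial.C b) ^ k *
    (Polynomial.C (-conj b) * Polynomial.X + Polynomial.C (conj a)) ^ (n - k)

lemma eval_mobPoly (n : ℕ) (f : Polynomial ℂ) (a b z : ℂ) :
    (mobPoly n f a b).eval z = homog n f (conj a - conj b * z) (a * z + b) := by
  rw [mobPoly, homog, Polynomial.eval_finsetSum]
  refine Finset.sum_congr rfl fun k _ => ?_
  simp only [Polynomial.eval_mul, Polynomial.eval_C, Polynomial.eval_pow, Polynomial.eval_add,
    Polynomial.eval_X]
  congr 2; ring

lemma natDegree_mobPoly_le (n : ℕ) (f : Polynomial ℂ) (a b : ℂ) :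
    (mobPoly n f a b).natDegree ≤ n := by
  refine Polynomial.natDegree_sum_le_of_forall_le _ _ fun k hk => ?_
  have hk : k ≤ n := Nat.lt_succ_iff.1 (Finset.mem_range.1 hk)
  have h1 := Polynomial.natDegree_pow_le_of_le k (Polynomial.natDegree_linear_le (a := a) (b := b))
  have h2 := Polynomial.natDegree_pow_le_of_le (n - k)
    (Polynomial.natDegree_linear_le (a := -conj b) (b := conj a))
  refine (Polynomial.natDegree_mul_le_of_le
    ((Polynomial.natDegree_C_mul_le _ _).trans h1) h2).trans ?_
  omega

lemma sphMod_mob {n : ℕ} {f : Polynomial ℂ} (hf : f.natDegree ≤ n) {a b z : ℂ}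
    (hab : ‖a‖ ^ 2 + ‖b‖ ^ 2 = 1) (hz : conj a - conj b * z ≠ 0) :
    sphMod n f (mob a b z) = sphMod n (mobPoly n f a b) z := by
  have h := homog_mul n f (conj a - conj b * z) 1 (mob a b z)
  rw [mul_one, homog_one hf, mob, mul_div_cancel₀ _ hz, ← eval_mobPoly] at h
  have hd : ‖conj a - conj b * z‖ ≠ 0 := norm_ne_zero_iff.2 hz
  have hp : (1 + ‖z‖ ^ 2 : ℝ) ≠ 0 := by positivity
  rw [sphMod, sphMod, mob_den_sq hz, hab, one_mul, h, norm_mul, norm_pow, mob, div_pow (1 + _)]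
  field_simp
  ring

/-- The maximum over the sphere, including the point at infinity. -/
lemma exists_isMax_mobPoly {n : ℕ} {f : Polynomial ℂ} (hf : f.natDegree ≤ n) :
    ∃ a b : ℂ, ‖a‖ ^ 2 + ‖b‖ ^ 2 = 1 ∧
      ∀ z, sphMod n f z ≤ ‖(mobPoly n f a b).eval 0‖ ^ 2 := by
  set S : Set (ℂ × ℂ) := {p | ‖p.1‖ ^ 2 + ‖p.2‖ ^ 2 = 1} with hS
  have hSc : IsCompact S := by
    refine Metric.isCompact_of_isClosed_isBounded
      (isClosed_eq (by fun_prop) continuous_const) ?_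
    refine (Metric.isBounded_closedBall (x := (0 : ℂ × ℂ)) (r := 1)).subset fun p hp => ?_
    have hp : ‖p.1‖ ^ 2 + ‖p.2‖ ^ 2 = 1 := hp
    rw [mem_closedBall_zero_iff, Prod.norm_def]
    refine max_le ?_ ?_ <;> nlinarith [norm_nonneg p.1, norm_nonneg p.2, sq_nonneg ‖p.1‖, sq_nonneg ‖p.2‖]
  have hSne : S.Nonempty := ⟨(1, 0), by simp [hS]⟩
  obtain ⟨p, hp, hmax⟩ := hSc.exists_isMaxOn hSne
    ((continuous_homog n f).norm.continuousOn)
  refine ⟨conj p.1, p.2, by simpa [hS] using hp, fun z => ?_⟩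
  rw [eval_mobPoly]
  simp only [Complex.conj_conj, mul_zero, sub_zero, zero_add]
  have h0 : (0 : ℝ) < 1 + ‖z‖ ^ 2 := by positivity
  set s : ℝ := (√(1 + ‖z‖ ^ 2))⁻¹ with hs
  have hs0 : 0 < s := by positivity
  have hs2 : s ^ 2 = (1 + ‖z‖ ^ 2)⁻¹ := by rw [hs, inv_pow, Real.sq_sqrt h0.le]
  have hmem : ((s : ℂ) * 1, (s : ℂ) * z) ∈ S := by
    simp only [hS, mem_ofPred_eq, norm_mul, norm_one, Complex.norm_real,
      Real.norm_of_nonneg hs0.le, mul_pow, hs2]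
    field_simp
  have h := hmax hmem
  simp only [mem_ofPred_eq] at h
  rw [homog_mul, homog_one hf, norm_mul, norm_pow, Complex.norm_real,
    Real.norm_of_nonneg hs0.le] at h
  have h2 := pow_le_pow_left₀ (by positivity) h 2
  refine le_trans (le_of_eq ?_) h2
  rw [sphMod, mul_pow, ← pow_mul, mul_comm n 2, pow_mul, hs2, inv_pow, div_eq_inv_mul]

lemma integral_re_monomial {n k : ℕ} (hk : k ≠ 0) (c : ℂ) :
    ∫ z, (c * z ^ k).re / (1 + ‖z‖ ^ 2) ^ n ∂sph = 0 := by
  set u := Complex.exp (((Real.pi / (2 * k) : ℝ) : ℂ) * Complex.I) with hu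
  have hun : ‖u‖ = 1 := Complex.norm_exp_ofReal_mul_I _
  have hu0 : u ≠ 0 := Complex.exp_ne_zero _
  have huk : (u ^ 2) ^ k = -1 := by
    rw [← pow_mul, hu, ← Complex.exp_nat_mul, ← Complex.exp_pi_mul_I]
    congr 1
    have : (k : ℂ) ≠ 0 := by exact_mod_cast hk
    push_cast
    field_simp
  have hmob : ∀ z, mob u 0 z = u ^ 2 * z := by
    intro z
    have : conj u = u⁻¹ := by
      rw [Complex.inv_def, Complex.normSq_eq_norm_sq, hun]; simp
    rw [mob, this, map_zero, zero_mul, sub_zero, add_zero, div_inv_eq_mul]; ring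
  have h := integral_mob (a := u) (b := 0) (Or.inl hu0)
    (g := fun z => (c * z ^ k).re / (1 + ‖z‖ ^ 2) ^ n) (by fun_prop)
  have h2 : ∀ z, (c * mob u 0 z ^ k).re / (1 + ‖mob u 0 z‖ ^ 2) ^ n =
      -((c * z ^ k).re / (1 + ‖z‖ ^ 2) ^ n) := by
    intro z
    rw [hmob, mul_pow, huk, norm_mul, norm_pow, hun, one_pow, one_mul, neg_one_mul, mul_neg,
      Complex.neg_re, neg_div]
  simp only [h2, integral_neg] at h
  linarith

lemma integrable_sphMod {n : ℕ} {f : Polynomial ℂ} (hf : f.natDegree ≤ n) :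
    Integrable (sphMod n f) sph := by
  obtain ⟨T, hT⟩ := exists_sphMod_le hf
  refine Integrable.of_bound (continuous_sphMod n f).aestronglyMeasurable T
    (Eventually.of_forall fun z => ?_)
  rw [Real.norm_of_nonneg (sphMod_nonneg n f z)]; exact hT z

lemma integrable_re_monomial {n k : ℕ} (hk : k ≤ n) (c : ℂ) :
    Integrable (fun z : ℂ => (c * z ^ k).re / (1 + ‖z‖ ^ 2) ^ n) sph := by
  have hcont : Continuous fun z : ℂ => (c * z ^ k).re / (1 + ‖z‖ ^ 2) ^ n :=
    Continuous.div₀ (by fun_prop) (by fun_prop) fun z => by positivity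
  refine Integrable.of_bound hcont.aestronglyMeasurable ‖c‖ (Eventually.of_forall fun z => ?_)
  have h0 : (0 : ℝ) < 1 + ‖z‖ ^ 2 := by positivity
  rw [norm_div, norm_pow, Real.norm_of_nonneg h0.le, div_le_iff₀ (by positivity)]
  refine (Complex.abs_re_le_norm _).trans ?_
  rw [norm_mul, norm_pow]
  gcongr
  calc ‖z‖ ^ k ≤ (1 + ‖z‖ ^ 2) ^ k := by gcongr; nlinarith [sq_nonneg (‖z‖ - 1)]
    _ ≤ (1 + ‖z‖ ^ 2) ^ n := pow_le_pow_right₀ (by nlinarith [sq_nonneg ‖z‖]) hk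

/-- The mean value property, in the form of an orthogonal decomposition. -/
lemma integral_sphMod_eq {n : ℕ} {g : Polynomial ℂ} (hg : g.natDegree ≤ n) :
    ∫ z, sphMod n g z ∂sph = ‖g.eval 0‖ ^ 2 / (n + 1) +
      ∫ z, sphMod n (g - Polynomial.C (g.eval 0)) z ∂sph := by
  have hg' : (g - Polynomial.C (g.eval 0)).natDegree ≤ n := by
    rw [Polynomial.natDegree_sub_C]; exact hg
  set d := g - Polynomial.C (g.eval 0) with hd
  have hsum : ∀ z, 2 * (conj (g.eval 0) * d.eval z).re / (1 + ‖z‖ ^ 2) ^ n =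
      ∑ k ∈ Finset.range n, (2 * conj (g.eval 0) * g.coeff (k + 1) * z ^ (k + 1)).re /
        (1 + ‖z‖ ^ 2) ^ n := by
    intro z
    rw [← Finset.sum_div, ← Complex.re_sum]
    congr 1
    rw [hd, Polynomial.eval_sub, Polynomial.eval_C, ← Polynomial.coeff_zero_eq_eval_zero,
      Polynomial.eval_eq_sum_range' (Nat.lt_succ_of_le hg), Finset.sum_range_succ', pow_zero,
      mul_one, add_sub_cancel_right, Finset.mul_sum,
      Complex.re_sum, Complex.re_sum, Finset.mul_sum]
    refine Finset.sum_congr rfl fun k _ => ?_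
    rw [mul_assoc, mul_assoc, ← Complex.re_ofReal_mul]
    simp
  have hmid : ∫ z, 2 * (conj (g.eval 0) * d.eval z).re / (1 + ‖z‖ ^ 2) ^ n ∂sph = 0 := by
    simp only [hsum]
    rw [integral_finsetSum _ fun k hk =>
      integrable_re_monomial (Nat.succ_le_of_lt (Finset.mem_range.1 hk)) _]
    exact Finset.sum_eq_zero fun k _ => integral_re_monomial (Nat.succ_ne_zero k) _
  have hmidI : Integrable
      (fun z => 2 * (conj (g.eval 0) * d.eval z).re / (1 + ‖z‖ ^ 2) ^ n) sph := by
    simp only [hsum]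
    exact integrable_finsetSum _ fun k hk =>
      integrable_re_monomial (Nat.succ_le_of_lt (Finset.mem_range.1 hk)) _
  have hconst : ∫ z, ‖g.eval 0‖ ^ 2 / (1 + ‖z‖ ^ 2) ^ n ∂sph = ‖g.eval 0‖ ^ 2 / (n + 1) := by
    have h : ∀ z : ℂ, ‖g.eval 0‖ ^ 2 / (1 + ‖z‖ ^ 2) ^ n =
        ‖g.eval 0‖ ^ 2 * (1 + ‖z‖ ^ 2) ^ (-(n : ℝ)) := by
      intro z
      rw [Real.rpow_neg (by positivity), Real.rpow_natCast, div_eq_mul_inv]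
    simp only [h]
    rw [integral_const_mul, integral_rpow_sph (by linarith [(Nat.cast_nonneg n : (0 : ℝ) ≤ n)]),
      mul_one_div]
  have hconstI : Integrable (fun z : ℂ => ‖g.eval 0‖ ^ 2 / (1 + ‖z‖ ^ 2) ^ n) sph := by
    have := integrable_sphMod (n := n) (f := Polynomial.C (g.eval 0)) (by simp)
    refine this.congr (Eventually.of_forall fun z => ?_)
    simp [sphMod]
  have hpt : ∀ z, sphMod n g z = ‖g.eval 0‖ ^ 2 / (1 + ‖z‖ ^ 2) ^ n +
      2 * (conj (g.eval 0) * d.eval z).re / (1 + ‖z‖ ^ 2) ^ n + sphMod n d z := by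
    intro z
    have hz : g.eval z = g.eval 0 + d.eval z := by
      rw [hd, Polynomial.eval_sub, Polynomial.eval_C]; ring
    rw [sphMod, sphMod, ← add_div, ← add_div, hz]
    congr 1
    rw [← Complex.normSq_eq_norm_sq, ← Complex.normSq_eq_norm_sq, ← Complex.normSq_eq_norm_sq,
      Complex.normSq_apply, Complex.normSq_apply, Complex.normSq_apply]
    simp
    ring
  simp only [hpt]
  have hadd := integral_add hconstI hmidI
  have hadd' := integral_add (hconstI.add hmidI) (integrable_sphMod hg')
  simp only [Pi.add_apply] at hadd hadd'
  rw [hadd', hadd, hmid, hconst, add_zero]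

lemma eq_zero_of_integral_sphMod_rpow {n : ℕ} {f : Polynomial ℂ} (hf : f.natDegree ≤ n) {α : ℝ}
    (hα : 0 < α) (h : ∫ z, sphMod n f z ^ α ∂sph ≤ 0) : f = 0 := by
  obtain ⟨T, hT⟩ := exists_sphMod_le hf
  have hc : Continuous fun z => sphMod n f z ^ α :=
    (continuous_sphMod n f).rpow_const fun _ => Or.inr hα.le
  have h0 : ∀ z, 0 ≤ sphMod n f z ^ α := fun z => Real.rpow_nonneg (sphMod_nonneg n f z) α
  have hI : Integrable (fun z => sphMod n f z ^ α) sph := by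
    refine Integrable.of_bound hc.aestronglyMeasurable (T ^ α) (Eventually.of_forall fun z => ?_)
    rw [Real.norm_of_nonneg (h0 z)]
    exact Real.rpow_le_rpow (sphMod_nonneg n f z) (hT z) hα.le
  have hz := (integral_eq_zero_iff_of_nonneg h0 hI).1 (le_antisymm h (integral_nonneg h0))
  have hz' := (hc.ae_eq_iff_eq sph continuous_const).1 hz
  refine Polynomial.funext fun z => ?_
  have h1 : sphMod n f z ^ α = 0 := congrFun hz' z
  rw [Real.rpow_eq_zero (sphMod_nonneg n f z) hα.ne', sphMod, div_eq_zero_iff] at h1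
  rcases h1 with h1 | h1
  · rw [Polynomial.eval_zero]; simpa using h1
  · exact absurd h1 (by positivity)

theorem exists_eval_eq_of_integral_le {n : ℕ} {f : Polynomial ℂ} (hf : f.natDegree ≤ n)
    (h : ∀ T, (∀ z, sphMod n f z ≤ T) → (n + 1) * ∫ z, sphMod n f z ∂sph ≤ T) :
    ∃ g a b : ℂ, ‖a‖ ^ 2 + ‖b‖ ^ 2 = 1 ∧ ∀ z, f.eval z = g * (a + conj b * z) ^ n := by
  obtain ⟨a, b, hab, hmax⟩ := exists_isMax_mobPoly hf
  have hab0 : a ≠ 0 ∨ b ≠ 0 := by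
    by_contra! h0
    simp [h0.1, h0.2] at hab
  have hle := h _ hmax
  set q := mobPoly n f a b with hq
  have hqn : q.natDegree ≤ n := natDegree_mobPoly_le n f a b
  have hint : ∫ z, sphMod n f z ∂sph = ∫ z, sphMod n q z ∂sph := by
    rw [← integral_mob hab0 (continuous_sphMod n f).measurable]
    refine integral_congr_ae ?_
    filter_upwards [ae_pole hab0] with z hz using sphMod_mob hf hab hz
  rw [hint, integral_sphMod_eq hqn, mul_add, mul_div_cancel₀ _ (by positivity)] at hle
  have hd0 : q - Polynomial.C (q.eval 0) = 0 := by
    refine eq_zero_of_integral_sphMod_rpow (n := n) (α := 1)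
      (by rw [Polynomial.natDegree_sub_C]; exact hqn) one_pos ?_
    simp only [Real.rpow_one]
    have hn : (0 : ℝ) < n + 1 := by positivity
    by_contra! hpos
    nlinarith [mul_pos hn hpos]
  refine ⟨q.eval 0, a, b, hab, ?_⟩
  set Q : Polynomial ℂ := Polynomial.C (conj b) * Polynomial.X + Polynomial.C a with hQ
  have hQ0 : Q ≠ 0 := by
    intro h0
    have h1 : Q.coeff 0 = 0 := by rw [h0]; simp
    have h2 : Q.coeff 1 = 0 := by rw [h0]; simp
    simp [hQ] at h1 h2
    simp [h1, h2] at hab0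
  have hQe : ∀ z, Q.eval z = a + conj b * z := fun z => by simp [hQ, add_comm]
  have hmul : f * Q = (Polynomial.C (q.eval 0) * Q ^ n) * Q := by
    refine Polynomial.funext fun z => ?_
    simp only [Polynomial.eval_mul, Polynomial.eval_pow, Polynomial.eval_C, hQe]
    rcases eq_or_ne (a + conj b * z) 0 with hz | hz
    · rw [hz]; simp
    congr 1
    have habc : a * conj a + b * conj b = 1 := by
      rw [Complex.mul_conj, Complex.mul_conj, Complex.normSq_eq_norm_sq, Complex.normSq_eq_norm_sq]
      exact_mod_cast hab
    have e := eval_mobPoly n f a b ((conj a * z - b) / (a + conj b * z))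
    rw [← hq, sub_eq_zero.1 hd0, Polynomial.eval_C,
      show conj a - conj b * ((conj a * z - b) / (a + conj b * z)) =
        (a + conj b * z)⁻¹ * 1 by field_simp; linear_combination habc,
      show a * ((conj a * z - b) / (a + conj b * z)) + b = (a + conj b * z)⁻¹ * z by
        rw [← mul_div_assoc, div_add' _ _ _ hz, div_eq_inv_mul]
        congr 1
        linear_combination z * habc,
      homog_mul, homog_one hf] at e
    rw [e, inv_pow]
    field_simp
  intro z
  rw [mul_right_cancel₀ hQ0 hmul]
  simp [hQe]

lemma polyNorm_eq (n : ℕ) (p : ℝ) (f : Polynomial ℂ) :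
    polyNorm n p f = ((n * (p / 2) + 1) * ∫ z, sphMod n f z ^ (p / 2) ∂sph) ^ (1 / p) := by
  rw [polyNorm, integral_sph, div_mul_eq_mul_div, mul_div_assoc, ← integral_div]
  have h : ∀ z : ℂ, ‖f.eval z‖ ^ p * (1 + ‖z‖ ^ 2) ^ (-(p * (n : ℝ) / 2) - 2) / Real.pi =
      sphDensity z * sphMod n f z ^ (p / 2) := by
    intro z
    have h0 : (0 : ℝ) < 1 + ‖z‖ ^ 2 := by positivity
    rw [sphDensity, sphMod, Real.div_rpow (by positivity) (by positivity), ← Real.rpow_natCast_mul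
      (norm_nonneg _), ← Real.rpow_natCast_mul h0.le, Real.rpow_sub h0, Real.rpow_neg h0.le,
      Real.rpow_two, show ((2 : ℕ) : ℝ) * (p / 2) = p by push_cast; ring,
      show (n : ℝ) * (p / 2) = p * n / 2 by ring]
    field_simp
  simp only [h]
  congr 3; ring

lemma polyNorm_zero (n : ℕ) {p : ℝ} (hp : 0 < p) : polyNorm n p 0 = 0 := by
  simp [polyNorm, Real.zero_rpow hp.ne', hp.ne']

lemma polyNorm_of_eval_eq {n : ℕ} {p : ℝ} (hp : 0 < p) {f : Polynomial ℂ} {g a b : ℂ}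
    (hab : ‖a‖ ^ 2 + ‖b‖ ^ 2 = 1) (hf : ∀ z, f.eval z = g * (a + conj b * z) ^ n) :
    polyNorm n p f = ‖g‖ := by
  have hab' : conj a ≠ 0 ∨ -b ≠ 0 := by
    by_contra! h0
    simp only [map_eq_zero, neg_eq_zero] at h0
    simp [h0.1, h0.2] at hab
  have hn : (0 : ℝ) ≤ n * (p / 2) := by positivity
  have key : ∀ z, conj (conj a) - conj (-b) * z ≠ 0 → sphMod n f z ^ (p / 2) =
      ‖g‖ ^ p * (1 + ‖mob (conj a) (-b) z‖ ^ 2) ^ (-(n * (p / 2))) := by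
    intro z hz
    have h0 : (0 : ℝ) < 1 + ‖z‖ ^ 2 := by positivity
    rw [mob_den_sq hz]
    simp only [Complex.conj_conj, map_neg, neg_mul, sub_neg_eq_add, norm_neg, RCLike.norm_conj]
      at hz ⊢
    rw [hab, one_mul, Real.rpow_neg (by positivity), ← Real.inv_rpow (by positivity), inv_div,
      Real.rpow_natCast_mul (by positivity), sphMod, hf, norm_mul, norm_pow, mul_pow, div_pow,
      mul_div_assoc, Real.mul_rpow (by positivity) (by positivity), ← Real.rpow_natCast_mul
      (norm_nonneg g), show ((2 : ℕ) : ℝ) * (p / 2) = p by push_cast; ring, ← pow_mul, ← pow_mul,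
      mul_comm n 2]
  have hint : ∫ z, sphMod n f z ^ (p / 2) ∂sph = ‖g‖ ^ p * (1 / (n * (p / 2) + 1)) := by
    rw [← integral_rpow_sph (by linarith : -1 < (n : ℝ) * (p / 2)),
      ← integral_mob hab' (g := fun z => (1 + ‖z‖ ^ 2) ^ (-((n : ℝ) * (p / 2)))) (by fun_prop),
      ← integral_const_mul]
    refine integral_congr_ae ?_
    filter_upwards [ae_pole hab'] with z hz using key z hz
  rw [polyNorm_eq, hint]
  have h1 : (n : ℝ) * (p / 2) + 1 ≠ 0 := by positivity
  rw [mul_left_comm, mul_one_div_cancel h1, mul_one, ← Real.rpow_mul (norm_nonneg g),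
    mul_one_div_cancel hp.ne', Real.rpow_one]

lemma exists_of_mem_polyOpt {n : ℕ} {f : Polynomial ℂ} (hf : f ∈ polyOpt n) :
    ∃ g a b : ℂ, ‖g‖ = 1 ∧ ‖a‖ ^ 2 + ‖b‖ ^ 2 = 1 ∧ ∀ z, f.eval z = g * (a + conj b * z) ^ n := by
  obtain ⟨θ, ⟨w, hw⟩ | h⟩ := hf
  · have h0 : (0 : ℝ) < 1 + ‖w‖ ^ 2 := by positivity
    set s : ℝ := √(1 + ‖w‖ ^ 2) with hs
    have hs0 : 0 < s := Real.sqrt_pos.2 h0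
    have hs2 : s ^ 2 = 1 + ‖w‖ ^ 2 := Real.sq_sqrt h0.le
    refine ⟨Complex.exp (Complex.I * θ), (s : ℂ)⁻¹, w / s, ?_, ?_, fun z => ?_⟩
    · rw [mul_comm, Complex.norm_exp_ofReal_mul_I]
    · rw [norm_inv, norm_div, Complex.norm_real, Real.norm_of_nonneg hs0.le, inv_pow, div_pow, hs2]
      field_simp
    · have hsC : (s : ℂ) ≠ 0 := by exact_mod_cast hs0.ne'
      have hp : (1 + ‖w‖ ^ 2) ^ ((n : ℝ) / 2) = s ^ n := by
        rw [← hs2, ← Real.rpow_natCast_mul hs0.le, ← Real.rpow_natCast]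
        congr 1; push_cast; ring
      rw [hw, hp, map_div₀, Complex.conj_ofReal, show (s : ℂ)⁻¹ + conj w / s * z =
        (1 + conj w * z) / s by ring, div_pow, mul_div_assoc, Complex.ofReal_pow]
  · refine ⟨Complex.exp (Complex.I * θ), 0, 1, ?_, by simp, fun z => by simp [h]⟩
    rw [mul_comm, Complex.norm_exp_ofReal_mul_I]

lemma exists_exp_eq {g : ℂ} (hg : ‖g‖ = 1) : ∃ θ : ℝ, Complex.exp (Complex.I * θ) = g :=
  ⟨g.arg, by rw [mul_comm]; simpa [hg] using Complex.norm_mul_exp_arg_mul_I g⟩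

lemma mem_polyOpt_of_eval_eq {n : ℕ} {f : Polynomial ℂ} {g a b : ℂ} (hg : ‖g‖ = 1)
    (hab : ‖a‖ ^ 2 + ‖b‖ ^ 2 = 1) (hf : ∀ z, f.eval z = g * (a + conj b * z) ^ n) :
    f ∈ polyOpt n := by
  rcases eq_or_ne a 0 with rfl | ha
  · have hb : ‖b‖ = 1 := by
      have : ‖b‖ ^ 2 = 1 := by simpa using hab
      exact (pow_eq_one_iff_of_nonneg (norm_nonneg b) two_ne_zero).1 this
    obtain ⟨θ, hθ⟩ := exists_exp_eq (g := g * conj b ^ n) (by simp [hg, hb])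
    refine ⟨θ, Or.inr fun z => ?_⟩
    rw [hθ, hf, zero_add, mul_pow, mul_assoc]
  · have ha0 : 0 < ‖a‖ := norm_pos_iff.2 ha
    have haC : (‖a‖ : ℂ) ≠ 0 := by exact_mod_cast ha0.ne'
    obtain ⟨θ, hθ⟩ := exists_exp_eq (g := g * (a / ‖a‖) ^ n) (by simp [hg, ha0.ne'])
    refine ⟨θ, Or.inl ⟨b / conj a, fun z => ?_⟩⟩
    have hw : 1 + ‖b / conj a‖ ^ 2 = ‖a‖⁻¹ ^ 2 := by
      rw [norm_div, RCLike.norm_conj, div_pow, inv_pow]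
      field_simp
      exact hab
    have hp : (1 + ‖b / conj a‖ ^ 2) ^ ((n : ℝ) / 2) = ‖a‖⁻¹ ^ n := by
      rw [hw, ← Real.rpow_natCast_mul (by positivity), ← Real.rpow_natCast]
      congr 1; push_cast; ring
    rw [hθ, hp, hf, map_div₀, Complex.conj_conj, show a + conj b * z = a * (1 + conj b / a * z) by
      field_simp, mul_pow, div_pow, Complex.ofReal_pow, Complex.ofReal_inv]
    field_simp
    rw [mul_assoc, ← mul_pow, mul_one_div_cancel haC, one_pow, mul_one]

theorem polyNorm_compare {n : ℕ} (hn : 1 ≤ n) {p q : ℝ} (hp : 0 < p) (hpq : p < q)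
    {f : Polynomial ℂ} (hf : f.natDegree ≤ n) (hf0 : f ≠ 0) :
    0 < polyNorm n p f ∧ polyNorm n q f ≤ polyNorm n p f ∧
    (polyNorm n q f = polyNorm n p f →
      ∃ g a b : ℂ, ‖a‖ ^ 2 + ‖b‖ ^ 2 = 1 ∧ ∀ z, f.eval z = g * (a + conj b * z) ^ n) := by
  have hq : 0 < q := hp.trans hpq
  have hJ : ∀ r, 0 < r → 0 < (n * (r / 2) + 1) * ∫ z, sphMod n f z ^ (r / 2) ∂sph := by
    intro r hr
    refine mul_pos (by positivity) (not_le.1 fun h => hf0 ?_)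
    exact eq_zero_of_integral_sphMod_rpow hf (by positivity) h
  have hN : ∀ r, 0 < r → 0 < polyNorm n r f := by
    intro r hr
    rw [polyNorm_eq]
    exact Real.rpow_pos_of_pos (hJ r hr) _
  have hNJ : ∀ r, 0 < r → (n * (r / 2) + 1) * ∫ z, sphMod n f z ^ (r / 2) ∂sph =
      (polyNorm n r f ^ 2) ^ (r / 2) := by
    intro r hr
    rw [← Real.rpow_natCast_mul (hN r hr).le, polyNorm_eq, ← Real.rpow_mul (hJ r hr).le,
      show 1 / r * (((2 : ℕ) : ℝ) * (r / 2)) = 1 by push_cast; field_simp, Real.rpow_one]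
  obtain ⟨T, hT⟩ := exists_sphMod_le hf
  have compare := fun T hT => moment_compare (μ := sph) (continuous_sphMod n f).measurable
    (sphMod_nonneg n f) (T := T) hT (N := n) (by exact_mod_cast hn)
    (fun a b ha hab hb => sphCdf_mul_rpow_le hn hf ha hab hb)
    (α := p / 2) (β := q / 2) (by positivity) (by linarith) (pow_pos (hN p hp) 2) (hNJ p hp)
  refine ⟨hN p hp, ?_, fun heq => exists_eval_eq_of_integral_le hf fun T hT => ?_⟩
  · have h := (compare T hT).1
    rw [hNJ q hq, Real.rpow_le_rpow_iff (by positivity) (by positivity) (by positivity)] at h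
    exact (pow_le_pow_iff_left₀ (hN q hq).le (hN p hp).le two_ne_zero).1 h
  · exact (compare T hT).2 (by rw [hNJ q hq, heq])

end SphereHolder

/-- **Bodmann's conjecture (Corollary 4.2, Case 2): sharp reverse Hölder inequality for
polynomials.** For an integer `n ≥ 1`, `0 < p < q < ∞` and every polynomial `f` of degree
`≤ n`, one has `‖f‖_{P_n,q} ≤ ‖f‖_{P_n,p}`, with equality if and only if `f = 0` or
`‖f‖_{P_n,p}⁻¹ f ∈ M₂`. -/
theorem reverse_holder_poly (n : ℕ) (hn : 1 ≤ n) (p q : ℝ) (hp : 0 < p) (hpq : p < q)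
    (f : Polynomial ℂ) (hf : f.natDegree ≤ n) :
    polyNorm n q f ≤ polyNorm n p f ∧
    (polyNorm n q f = polyNorm n p f ↔
      f = 0 ∨ Polynomial.C (((polyNorm n p f : ℝ) : ℂ))⁻¹ * f ∈ polyOpt n) := by
  have hq : 0 < q := hp.trans hpq
  rcases eq_or_ne f 0 with rfl | hf0
  · simp [SphereHolder.polyNorm_zero n hp, SphereHolder.polyNorm_zero n hq]
  obtain ⟨hN, hle, heq⟩ := SphereHolder.polyNorm_compare hn hp hpq hf hf0
  have hNC : ((polyNorm n p f : ℝ) : ℂ) ≠ 0 := by exact_mod_cast hN.ne'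
  refine ⟨hle, fun h => Or.inr ?_, fun h => ?_⟩
  · obtain ⟨g, a, b, hab, hfe⟩ := heq h
    have hg : polyNorm n p f = ‖g‖ := SphereHolder.polyNorm_of_eval_eq hp hab hfe
    refine SphereHolder.mem_polyOpt_of_eval_eq (g := ((polyNorm n p f : ℝ) : ℂ)⁻¹ * g) ?_ hab fun z => ?_
    · rw [norm_mul, norm_inv, Complex.norm_real, Real.norm_of_nonneg hN.le, ← hg,
        inv_mul_cancel₀ hN.ne']
    · rw [Polynomial.eval_mul, Polynomial.eval_C, hfe, mul_assoc]
  · obtain ⟨g, a, b, -, hab, hfe⟩ := SphereHolder.exists_of_mem_polyOpt (h.resolve_left hf0)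
    have hfe' : ∀ z, f.eval z =
        ((polyNorm n p f : ℝ) : ℂ) * g * (a + (starRingEnd ℂ) b * z) ^ n := by
      intro z
      rw [mul_assoc, ← hfe z, Polynomial.eval_mul, Polynomial.eval_C, mul_inv_cancel_left₀ hNC]
    rw [SphereHolder.polyNorm_of_eval_eq hp hab hfe', SphereHolder.polyNorm_of_eval_eq hq hab hfe']
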